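/- arXiv:2505.05342 — 3 statements merged into one kernel-verified Lean document; each statement's English description precedes it below -/
import Mathlib

section
/- Suppose 𝒱 satisfies the single-well hypotheses. Then for each λ ∈ (0, λ_max], the restriction of the Langer transformation g(·;λ) to the interval (x₋(λ), ∞) is of class C³ and maps (x₋(λ), ∞) onto (−2√(−b), ∞). -/
open MeasureTheory Set

noncomputable def pdermix (V : ℝ → ℝ → ℝ) (m n : ℕ) (x lam : ℝ) : ℝ :=
  iteratedDeriv m (fun l => iteratedDeriv n (fun x' => V x' l) x) lam

structure SingleWell (V : ℝ → ℝ → ℝ) (lammax δ pp pm Vp Vm : ℝ) : Prop where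
  lammax_pos : 0 < lammax
  delta_pos : 0 < δ
  pp_nonneg : 0 ≤ pp
  pm_nonneg : 0 ≤ pm
  Vp_pos : 0 < Vp
  Vm_pos : 0 < Vm
  smooth : ∀ lam ∈ Icc (0:ℝ) lammax, ContDiff ℝ 5 (fun x => V x lam)
  V_zero : ∀ lam ∈ Icc (0:ℝ) lammax, V 0 lam = 0
  dV_zero : ∀ lam ∈ Icc (0:ℝ) lammax, deriv (fun x => V x lam) 0 = 0
  d2V_pos : ∀ lam ∈ Icc (0:ℝ) lammax, 0 < iteratedDeriv 2 (fun x => V x lam) 0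
  dV_pos : ∀ lam ∈ Icc (0:ℝ) lammax, ∀ x : ℝ, 0 < x → 0 < deriv (fun x' => V x' lam) x
  dV_neg : ∀ lam ∈ Icc (0:ℝ) lammax, ∀ x : ℝ, x < 0 → deriv (fun x' => V x' lam) x < 0
  asympP : ∀ η > (0:ℝ), ∃ X > (0:ℝ), ∀ lam ∈ Icc (0:ℝ) lammax, ∀ x ≥ X,
      |V x lam - Vp * |x| ^ pp| ≤ η * (Vp * |x| ^ pp)
  asympM : ∀ η > (0:ℝ), ∃ X > (0:ℝ), ∀ lam ∈ Icc (0:ℝ) lammax, ∀ x ≤ -X,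
      |V x lam - Vm * |x| ^ pm| ≤ η * (Vm * |x| ^ pm)
  derivP : ∃ C > (0:ℝ), ∃ X > (0:ℝ), ∀ lam ∈ Icc (0:ℝ) lammax, ∀ x ≥ X,
      |deriv (fun x' => V x' lam) x| ≤ C * |x| ^ (pp - 1) ∧
      |iteratedDeriv 2 (fun x' => V x' lam) x| ≤ C * |x| ^ (pp - 2)
  derivM : ∃ C > (0:ℝ), ∃ X > (0:ℝ), ∀ lam ∈ Icc (0:ℝ) lammax, ∀ x ≤ -X,
      |deriv (fun x' => V x' lam) x| ≤ C * |x| ^ (pm - 1) ∧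
      |iteratedDeriv 2 (fun x' => V x' lam) x| ≤ C * |x| ^ (pm - 2)
  mixed_cont : ∀ m ≤ 2, ∀ n ≤ 5, ContinuousOn
      (fun p : ℝ × ℝ => pdermix V m n p.1 p.2)
      (Ioo (-δ) δ ×ˢ Icc (0:ℝ) lammax)

/-- The defining properties of the Langer transformation for potential `W := 𝒱(·;λ) - λ`
(so that the right-hand side of the ODE is `W x`), turning points `xm < xp`, parameter `b < 0`. -/
def IsLanger (W : ℝ → ℝ) (xm xp b : ℝ) (g : ℝ → ℝ) : Prop :=
  Continuous g ∧ StrictMono g ∧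
  g xp = 2 * Real.sqrt (-b) ∧ g xm = -(2 * Real.sqrt (-b)) ∧
  ∀ x : ℝ, x ≠ xm → x ≠ xp →
    DifferentiableAt ℝ g x ∧ 0 < deriv g x ∧
    (deriv g x) ^ 2 * ((1/4) * (g x) ^ 2 + b) = W x

noncomputable def bParam (W : ℝ → ℝ) (xm xp : ℝ) : ℝ :=
  -(1 / Real.pi) * ∫ x in xm..xp, Real.sqrt (-(W x))

open scoped Topology

/-- The average of `f` over the segment from `p` to `x`, with weight `φ`. -/
noncomputable def segmentIntegral (φ f : ℝ → ℝ) (p x : ℝ) : ℝ :=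
  ∫ t in (0:ℝ)..1, φ t * f (p + t * (x - p))

lemma segment_point_mem {s : Set ℝ} (hs : Convex ℝ s) {p x t : ℝ} (hp : p ∈ s) (hx : x ∈ s)
    (ht : t ∈ Icc (0:ℝ) 1) : p + t * (x - p) ∈ s := by
  simpa using hs.add_smul_sub_mem hp hx ht

lemma continuousOn_segment_integrand {φ f : ℝ → ℝ} {s : Set ℝ} (hs : Convex ℝ s)
    (hφ : Continuous φ) (hf : ContinuousOn f s) {p x : ℝ} (hp : p ∈ s) (hx : x ∈ s) :
    ContinuousOn (fun t => φ t * f (p + t * (x - p))) (uIcc 0 1) := by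
  rw [uIcc_of_le zero_le_one]
  exact hφ.continuousOn.mul (hf.comp (by fun_prop) fun t ht => segment_point_mem hs hp hx ht)

lemma exists_segment_integrand_bound {φ f : ℝ → ℝ} {s : Set ℝ} (hs : Convex ℝ s) (ho : IsOpen s)
    (hφ : Continuous φ) (hf : ContinuousOn f s) {p x : ℝ} (hp : p ∈ s) (hx : x ∈ s) :
    ∃ K ∈ 𝓝 x, K ⊆ s ∧ ∃ C : ℝ, ∀ t ∈ Icc (0:ℝ) 1, ∀ y ∈ K,
      ‖φ t * f (p + t * (y - p))‖ ≤ C := by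
  obtain ⟨ε, hε, hεs⟩ := Metric.nhds_basis_closedBall.mem_iff.1 (ho.mem_nhds hx)
  obtain ⟨C, hC⟩ := (isCompact_Icc.prod (isCompact_closedBall x ε)).exists_bound_of_continuousOn
    (s := Icc (0:ℝ) 1 ×ˢ Metric.closedBall x ε)
    (f := fun q : ℝ × ℝ => φ q.1 * f (p + q.1 * (q.2 - p)))
    ((by fun_prop : Continuous fun q : ℝ × ℝ => φ q.1).continuousOn.mul
      (hf.comp (by fun_prop) fun q hq => segment_point_mem hs hp (hεs hq.2) hq.1))
  exact ⟨_, Metric.closedBall_mem_nhds x hε, hεs, C, fun t ht y hy => hC (t, y) ⟨ht, hy⟩⟩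

lemma continuousOn_segmentIntegral {φ f : ℝ → ℝ} {s : Set ℝ} (hs : Convex ℝ s) (ho : IsOpen s)
    (hφ : Continuous φ) (hf : ContinuousOn f s) {p : ℝ} (hp : p ∈ s) :
    ContinuousOn (segmentIntegral φ f p) s := by
  intro x hx
  apply ContinuousAt.continuousWithinAt
  obtain ⟨K, hK, hKs, C, hC⟩ := exists_segment_integrand_bound hs ho hφ hf hp hx
  refine intervalIntegral.continuousAt_of_dominated_interval (bound := fun _ => C) ?_ ?_ (by simp) ?_
  · filter_upwards [hK] with y hy
    exact (continuousOn_segment_integrand hs hφ hf hp (hKs hy)).intervalIntegrable.def'.1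
  · filter_upwards [hK] with y hy
    refine .of_forall fun t ht => hC t ?_ y hy
    rw [uIoc_of_le zero_le_one] at ht
    exact Ioc_subset_Icc_self ht
  · refine .of_forall fun t ht => ?_
    rw [uIoc_of_le zero_le_one] at ht
    have := hf.continuousAt (ho.mem_nhds (segment_point_mem hs hp hx (Ioc_subset_Icc_self ht)))
    exact continuousAt_const.mul
      (ContinuousAt.comp (f := fun y => p + t * (y - p)) this (by fun_prop))

lemma hasDerivAt_segmentIntegral {φ f : ℝ → ℝ} {s : Set ℝ} (hs : Convex ℝ s) (ho : IsOpen s)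
    (hφ : Continuous φ) (hf : ContDiffOn ℝ 1 f s) {p x : ℝ} (hp : p ∈ s) (hx : x ∈ s) :
    HasDerivAt (segmentIntegral φ f p) (segmentIntegral (fun t => φ t * t) (deriv f) p x) x := by
  have hφ' : Continuous fun t => φ t * t := by fun_prop
  have hf' : ContinuousOn (deriv f) s := hf.continuousOn_deriv_of_isOpen ho le_rfl
  obtain ⟨K, hK, hKs, C, hC⟩ := exists_segment_integrand_bound hs ho hφ' hf' hp hx
  refine (intervalIntegral.hasDerivAt_integral_of_dominated_loc_of_deriv_le
    (F' := fun y t => φ t * t * deriv f (p + t * (y - p)))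
    (bound := fun _ => C) hK ?_ ?_ ?_ ?_ (by simp) ?_).2
  · filter_upwards [hK] with y hy
    exact (continuousOn_segment_integrand hs hφ hf.continuousOn hp
      (hKs hy)).intervalIntegrable.def'.1
  · exact (continuousOn_segment_integrand hs hφ hf.continuousOn hp hx).intervalIntegrable
  · exact (continuousOn_segment_integrand hs hφ' hf' hp hx).intervalIntegrable.def'.1
  · refine .of_forall fun t ht y hy => hC t ?_ y hy
    rw [uIoc_of_le zero_le_one] at ht
    exact Ioc_subset_Icc_self ht
  · refine .of_forall fun t ht y hy => ?_
    rw [uIoc_of_le zero_le_one] at ht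
    have hd := ((hf.differentiableOn one_ne_zero).differentiableAt
      (ho.mem_nhds (segment_point_mem hs hp (hKs hy) (Ioc_subset_Icc_self ht)))).hasDerivAt
    have hl : HasDerivAt (fun y : ℝ => p + t * (y - p)) t y := by
      simpa using (((hasDerivAt_id y).sub_const p).const_mul t).const_add p
    exact ((hd.comp y hl).const_mul (φ t)).congr_deriv (by ring)

lemma contDiffOn_segmentIntegral {n : ℕ} {φ f : ℝ → ℝ} {s : Set ℝ} (hs : Convex ℝ s)
    (ho : IsOpen s) (hφ : Continuous φ) (hf : ContDiffOn ℝ n f s) {p : ℝ} (hp : p ∈ s) :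
    ContDiffOn ℝ n (segmentIntegral φ f p) s := by
  induction n generalizing φ f with
  | zero =>
    exact contDiffOn_zero.2 (continuousOn_segmentIntegral hs ho hφ hf.continuousOn hp)
  | succ n ih =>
    have h1 : ContDiffOn ℝ 1 f s := hf.of_le (by norm_cast; omega)
    have hd := fun x (hx : x ∈ s) => hasDerivAt_segmentIntegral hs ho hφ h1 hp hx
    push_cast at hf ⊢
    rw [contDiffOn_succ_iff_deriv_of_isOpen ho] at hf ⊢
    refine ⟨fun x hx => (hd x hx).differentiableAt.differentiableWithinAt, by simp, ?_⟩
    exact (ih (φ := fun t => φ t * t) (by fun_prop) hf.2.2).congr fun x hx => (hd x hx).deriv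

/-- Integration by parts on a segment. -/
lemma segmentIntegral_mul_deriv {φ φ' f : ℝ → ℝ} {s : Set ℝ} (hs : Convex ℝ s) (ho : IsOpen s)
    (hφ : ∀ t, HasDerivAt φ (φ' t) t) (hφ' : Continuous φ') (hf : ContDiffOn ℝ 1 f s) {p x : ℝ}
    (hp : p ∈ s) (hx : x ∈ s) :
    segmentIntegral φ' f p x + (x - p) * segmentIntegral φ (deriv f) p x =
      φ 1 * f x - φ 0 * f p := by
  have hφc : Continuous φ := continuous_iff_continuousAt.2 fun t => (hφ t).continuousAt
  have hf' : ContinuousOn (deriv f) s := hf.continuousOn_deriv_of_isOpen ho le_rfl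
  have i1 := (continuousOn_segment_integrand hs hφ' hf.continuousOn hp hx).intervalIntegrable
    (μ := volume)
  have i2 := (continuousOn_segment_integrand hs hφc hf' hp hx).intervalIntegrable (μ := volume)
  have := intervalIntegral.integral_eq_sub_of_hasDerivAt (a := 0) (b := 1)
    (f := fun t => φ t * f (p + t * (x - p)))
    (f' := fun t => φ' t * f (p + t * (x - p)) + (x - p) * (φ t * deriv f (p + t * (x - p))))
    (fun t ht => ?_) (i1.add (i2.const_mul (x - p)))
  · rw [intervalIntegral.integral_add i1 (i2.const_mul _),
      intervalIntegral.integral_const_mul] at this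
    simpa [segmentIntegral] using this
  · rw [uIcc_of_le zero_le_one] at ht
    have hd := ((hf.differentiableOn one_ne_zero).differentiableAt
      (ho.mem_nhds (segment_point_mem hs hp hx ht))).hasDerivAt
    have hl : HasDerivAt (fun t : ℝ => p + t * (x - p)) (x - p) t := by
      simpa using ((hasDerivAt_id t).mul_const (x - p)).const_add p
    exact ((hφ t).mul (hd.comp t hl)).congr_deriv (by simp only [Function.comp]; ring)

lemma segmentIntegral_pos {φ f : ℝ → ℝ} {s : Set ℝ} (hs : Convex ℝ s)
    (hφ : Continuous φ) (hφ0 : ∀ t ∈ Ioo (0:ℝ) 1, 0 < φ t) (hf : ContinuousOn f s)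
    (hf0 : ∀ x ∈ s, 0 < f x) {p x : ℝ} (hp : p ∈ s) (hx : x ∈ s) :
    0 < segmentIntegral φ f p x :=
  intervalIntegral.intervalIntegral_pos_of_pos_on
    (continuousOn_segment_integrand hs hφ hf hp hx).intervalIntegrable
    (fun t ht => mul_pos (hφ0 t ht) (hf0 _ (segment_point_mem hs hp hx (Ioo_subset_Icc_self ht))))
    zero_lt_one

/-- The Airy variable at a simple turning point. -/
lemma exists_airy_variable {n : ℕ} (hn : n ≠ 0) {W : ℝ → ℝ} {s : Set ℝ} (hs : Convex ℝ s)
    (ho : IsOpen s) (hW : ContDiffOn ℝ (n + 1) W s) {p : ℝ} (hp : p ∈ s) (hWp : W p = 0)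
    (hdW : 0 < deriv W p) (hpos : ∀ x ∈ s, p < x → 0 < W x) (hneg : ∀ x ∈ s, x < p → W x < 0) :
    ∃ ζ : ℝ → ℝ, ContDiffOn ℝ n ζ s ∧ ζ p = 0 ∧ ∀ x ∈ s, 0 < deriv ζ x ∧
      ζ x * deriv ζ x ^ 2 = W x := by
  have hn1 : (1 : WithTop ℕ∞) ≤ n := by exact_mod_cast Nat.one_le_iff_ne_zero.2 hn
  have hW' : ContDiffOn ℝ n (deriv W) s := ((contDiffOn_succ_iff_deriv_of_isOpen ho).1 hW).2.2
  set w := segmentIntegral (fun _ => 1) (deriv W) p with hw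
  have hwC : ContDiffOn ℝ n w s := contDiffOn_segmentIntegral hs ho continuous_const hW' hp
  have hwW : ∀ x ∈ s, (x - p) * w x = W x := fun x hx => by
    have := segmentIntegral_mul_deriv (φ := fun _ => 1) (φ' := fun _ => 0) hs ho
      (fun t => hasDerivAt_const t 1) continuous_const
      (hW.of_le (by simp)) hp hx
    simpa [segmentIntegral, hw, hWp] using this
  have hw0 : ∀ x ∈ s, 0 < w x := fun x hx => by
    rcases lt_trichotomy x p with h | h | h
    · nlinarith [hwW x hx, hneg x hx h]
    · subst h
      simpa [hw, segmentIntegral] using hdW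
    · nlinarith [hwW x hx, hpos x hx h]
  set v := fun x => √(w x) with hv
  have hvC : ContDiffOn ℝ n v s := hwC.sqrt fun x hx => (hw0 x hx).ne'
  have hv0 : ∀ x ∈ s, 0 < v x := fun x hx => Real.sqrt_pos.2 (hw0 x hx)
  have hφ : Continuous fun t : ℝ => 3 / 2 * t ^ (1 / 2 : ℝ) := by
    have := Real.continuous_rpow_const (q := 1 / 2) (by norm_num)
    fun_prop
  set A := segmentIntegral (fun t => 3 / 2 * t ^ (1 / 2 : ℝ)) v p with hA
  have hAC : ContDiffOn ℝ n A s := contDiffOn_segmentIntegral hs ho hφ hvC hp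
  have hA0 : ∀ x ∈ s, 0 < A x := fun x hx => segmentIntegral_pos hs hφ
    (fun t ht => mul_pos (by norm_num) (Real.rpow_pos_of_pos ht.1 _)) hvC.continuousOn hv0 hp hx
  have hAd : ∀ x ∈ s, HasDerivAt A (deriv A x) x := fun x hx =>
    ((hAC.differentiableOn (by simpa using hn)).differentiableAt (ho.mem_nhds hx)).hasDerivAt
  have hAv : ∀ x ∈ s, A x + (2 / 3) * (x - p) * deriv A x = v x := fun x hx => by
    have h1 := segmentIntegral_mul_deriv (φ := fun t => t ^ (3 / 2 : ℝ)) hs ho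
      (fun t => Real.hasDerivAt_rpow_const (Or.inr (by norm_num)))
      (by norm_num only; exact hφ) (hvC.of_le hn1) hp hx
    have h2 := (hasDerivAt_segmentIntegral hs ho hφ (hvC.of_le hn1) hp hx).deriv
    have h3 : segmentIntegral (fun t => 3 / 2 * t ^ (1 / 2 : ℝ) * t) (deriv v) p x =
        3 / 2 * segmentIntegral (fun t => t ^ (3 / 2 : ℝ)) (deriv v) p x := by
      unfold segmentIntegral
      rw [← intervalIntegral.integral_const_mul]
      refine intervalIntegral.integral_congr fun t ht => ?_
      rw [uIcc_of_le zero_le_one] at ht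
      have : t ^ (3 / 2 : ℝ) = t ^ (1 / 2 : ℝ) * t := by
        rw [show (3 / 2 : ℝ) = 1 / 2 + 1 by norm_num,
          Real.rpow_add_of_nonneg ht.1 (by norm_num) (by norm_num), Real.rpow_one]
      simp only [this]
      ring
    rw [hA, h2, h3]
    norm_num at h1
    norm_num
    linarith
  set u := fun x => A x ^ (2 / 3 : ℝ) with hu
  have hud : ∀ x ∈ s, HasDerivAt (fun x => (x - p) * u x) (A x ^ (-1 / 3 : ℝ) * v x) x := by
    intro x hx
    have h := ((hasDerivAt_id x).sub_const p).mul
      ((hAd x hx).rpow_const (p := 2 / 3) (Or.inl (hA0 x hx).ne'))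
    refine h.congr_deriv ?_
    have : A x ^ (2 / 3 : ℝ) = A x ^ (-1 / 3 : ℝ) * A x := by
      nth_rw 3 [← Real.rpow_one (A x)]
      rw [← Real.rpow_add (hA0 x hx)]
      norm_num
    rw [← hAv x hx, this, show (2 / 3 - 1 : ℝ) = -1 / 3 by norm_num]
    simp only [id]
    ring
  refine ⟨fun x => (x - p) * u x, ?_, by simp, fun x hx => ?_⟩
  · exact (contDiffOn_id.sub contDiffOn_const).mul
      (hAC.rpow_const_of_ne fun x hx => (hA0 x hx).ne')
  · rw [(hud x hx).deriv]
    refine ⟨mul_pos (Real.rpow_pos_of_pos (hA0 x hx) _) (hv0 x hx), ?_⟩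
    have h1 : u x * (A x ^ (-1 / 3 : ℝ)) ^ 2 = 1 := by
      rw [hu, ← Real.rpow_natCast, ← Real.rpow_mul (hA0 x hx).le, ← Real.rpow_add (hA0 x hx)]
      norm_num
    rw [← hwW x hx, ← Real.sq_sqrt (hw0 x hx).le]
    linear_combination (x - p) * v x ^ 2 * h1

/-- On one side of the turning point, solutions of `h * h' ^ 2 = W` are unique. -/
lemma airy_variable_unique_right {W h k : ℝ → ℝ} {p x : ℝ} (hpx : p < x)
    (hhc : ContinuousOn h (Icc p x)) (hkc : ContinuousOn k (Icc p x)) (hhp : h p = 0)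
    (hkp : k p = 0) (hW : ∀ y ∈ Ioc p x, 0 < W y)
    (hh : ∀ y ∈ Ioc p x, ∃ d, HasDerivAt h d y ∧ 0 < d ∧ h y * d ^ 2 = W y)
    (hk : ∀ y ∈ Ioc p x, ∃ d, HasDerivAt k d y ∧ 0 < d ∧ k y * d ^ 2 = W y) :
    h x = k x := by
  have key : ∀ f : ℝ → ℝ, (∀ y ∈ Ioc p x, ∃ d, HasDerivAt f d y ∧ 0 < d ∧ f y * d ^ 2 = W y) →
      ∀ y ∈ Ioc p x, 0 < f y ∧
        HasDerivAt (fun y => f y ^ (3 / 2 : ℝ)) (3 / 2 * √(W y)) y := by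
    intro f hf y hy
    obtain ⟨d, hd, hd0, hfd⟩ := hf y hy
    have hfy : 0 < f y := pos_of_mul_pos_left (hfd ▸ hW y hy) (sq_nonneg d)
    refine ⟨hfy, (hd.rpow_const (p := 3 / 2) (Or.inl hfy.ne')).congr_deriv ?_⟩
    rw [← hfd, Real.sqrt_mul hfy.le, Real.sqrt_sq hd0.le, Real.sqrt_eq_rpow,
      show (3 / 2 - 1 : ℝ) = 1 / 2 by norm_num]
    ring
  obtain ⟨c, -, hc⟩ := exists_hasDerivAt_eq_slope
    (fun y => h y ^ (3 / 2 : ℝ) - k y ^ (3 / 2 : ℝ)) (fun _ => 0) hpx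
    ((hhc.rpow_const fun _ _ => Or.inr (by norm_num)).sub
      (hkc.rpow_const fun _ _ => Or.inr (by norm_num)))
    (fun y hy => ((key h hh y (Ioo_subset_Ioc_self hy)).2.sub
      (key k hk y (Ioo_subset_Ioc_self hy)).2).congr_deriv (sub_self _))
  have hx : x ∈ Ioc p x := right_mem_Ioc.2 hpx
  rw [hhp, hkp, sub_self, sub_zero, eq_comm, div_eq_zero_iff,
    or_iff_left (sub_pos.2 hpx).ne', sub_eq_zero] at hc
  exact (Real.rpow_left_inj (key h hh x hx).1.le (key k hk x hx).1.le (by norm_num)).1 hc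

/-- Solutions of `h * h' ^ 2 = W` that vanish at the turning point are unique. -/
lemma airy_variable_unique {W h k : ℝ → ℝ} {s : Set ℝ} (hs : Convex ℝ s) {p : ℝ} (hp : p ∈ s)
    (hhc : ContinuousOn h s) (hkc : ContinuousOn k s) (hhp : h p = 0) (hkp : k p = 0)
    (hpos : ∀ x ∈ s, p < x → 0 < W x) (hneg : ∀ x ∈ s, x < p → W x < 0)
    (hh : ∀ y ∈ s, y ≠ p → ∃ d, HasDerivAt h d y ∧ 0 < d ∧ h y * d ^ 2 = W y)
    (hk : ∀ y ∈ s, y ≠ p → ∃ d, HasDerivAt k d y ∧ 0 < d ∧ k y * d ^ 2 = W y) :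
    EqOn h k s := by
  intro x hx
  rcases lt_trichotomy x p with hxp | rfl | hpx
  · have hI : ∀ y ∈ Icc (-p) (-x), -y ∈ s := fun y hy =>
      hs.ordConnected.out hx hp ⟨le_neg.1 hy.2, neg_le.1 hy.1⟩
    have hne : ∀ y ∈ Ioc (-p) (-x), -y < p := fun y hy => neg_lt.1 hy.1
    have reflect : ∀ f : ℝ → ℝ,
        (∀ y ∈ s, y ≠ p → ∃ d, HasDerivAt f d y ∧ 0 < d ∧ f y * d ^ 2 = W y) →
        ∀ y ∈ Ioc (-p) (-x), ∃ d, HasDerivAt (fun y => -f (-y)) d y ∧ 0 < d ∧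
          -f (-y) * d ^ 2 = -W (-y) := by
      intro f hf y hy
      obtain ⟨d, hd, hd0, hfd⟩ := hf (-y) (hI y (Ioc_subset_Icc_self hy)) (hne y hy).ne
      exact ⟨d, (hd.comp y (hasDerivAt_neg y)).neg.congr_deriv (by ring), hd0, by rw [← hfd]; ring⟩
    have := airy_variable_unique_right (W := fun y => -W (-y)) (h := fun y => -h (-y))
      (k := fun y => -k (-y)) (neg_lt_neg hxp) (hhc.comp continuousOn_neg hI).neg
      (hkc.comp continuousOn_neg hI).neg (by simpa) (by simpa)
      (fun y hy => neg_pos.2 (hneg _ (hI y (Ioc_subset_Icc_self hy)) (hne y hy)))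
      (reflect h hh) (reflect k hk)
    simpa using this
  · rw [hhp, hkp]
  · have hI : Icc p x ⊆ s := hs.ordConnected.out hp hx
    exact airy_variable_unique_right hpx (hhc.mono hI) (hkc.mono hI) hhp hkp
      (fun y hy => hpos y (hI (Ioc_subset_Icc_self hy)) hy.1)
      (fun y hy => hh y (hI (Ioc_subset_Icc_self hy)) hy.1.ne')
      (fun y hy => hk y (hI (Ioc_subset_Icc_self hy)) hy.1.ne')

/-- A continuous solution of `f ∘ g = h` is as smooth as `f` and `h` where `deriv f` does not
vanish. -/
lemma contDiffAt_of_comp_eventuallyEq {n : WithTop ℕ∞} (hn : n ≠ 0) {f g h : ℝ → ℝ} {x : ℝ}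
    (hf : ContDiffAt ℝ n f (g x)) (hf' : deriv f (g x) ≠ 0) (hh : ContDiffAt ℝ n h x)
    (hg : ContinuousAt g x) (hfg : f ∘ g =ᶠ[𝓝 x] h) : ContDiffAt ℝ n g x := by
  have hd : HasFDerivAt f
      (ContinuousLinearEquiv.unitsEquivAut ℝ (Units.mk0 _ hf') : ℝ →L[ℝ] ℝ) (g x) :=
    ((hf.differentiableAt hn).hasDerivAt.hasFDerivAt).congr_fderiv (by ext; simp)
  have hl : ContDiffAt ℝ n (hf.localInverse hd hn) (h x) :=
    hfg.eq_of_nhds ▸ hf.to_localInverse hd hn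
  refine (hl.comp x hh).congr_of_eventuallyEq ?_
  filter_upwards [hfg, hg.eventually (hf.hasStrictFDerivAt' hd hn).eventually_left_inverse]
    with y hy hy'
  rw [Function.comp_apply, ← hy]
  exact hy'.symm

lemma single_well_lt_and_strictMonoOn {U : ℝ → ℝ} (hU : Differentiable ℝ U)
    (hpos : ∀ x, 0 < x → 0 < deriv U x) (hneg : ∀ x, x < 0 → deriv U x < 0) {xm xp c : ℝ}
    (hm : xm < 0) (hp : 0 < xp) (hUm : U xm = c) (hUp : U xp = c) :
    (∀ x ∈ Ioo xm xp, U x < c) ∧ StrictMonoOn U (Ici 0) := by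
  have h1 : StrictMonoOn U (Ici 0) := strictMonoOn_of_deriv_pos (convex_Ici 0)
    hU.continuous.continuousOn (by simpa using hpos)
  have h2 : StrictAntiOn U (Iic 0) := strictAntiOn_of_deriv_neg (convex_Iic 0)
    hU.continuous.continuousOn (by simpa using hneg)
  refine ⟨fun x hx => ?_, h1⟩
  rcases le_total 0 x with h | h
  · exact hUp ▸ h1 h hp.le hx.2
  · exact hUm ▸ h2 hm.le h hx.1

/-- A Langer transformation is unbounded above if the potential increases on the right. -/
lemma IsLanger.exists_gt {W g : ℝ → ℝ} {xm xp b : ℝ} (hg : IsLanger W xm xp b g)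
    (hm : xm < xp) (hW : StrictMonoOn W (Ici xp)) (hWp : W xp = 0) (M : ℝ) :
    ∃ x > xp, M < g x := by
  obtain ⟨hgc, hmono, hgp, -, hode⟩ := hg
  by_contra! hM
  have hc : 0 < W (xp + 1) := hWp ▸ hW self_mem_Ici (by simp) (by linarith)
  set c := W (xp + 1)
  set D := M ^ 2 / 4 + |b| + 1 with hD
  have hD0 : 0 < D := by positivity
  have hd : ∀ x ∈ interior (Ici (xp + 1)), √(c / D) ≤ deriv g x := by
    rw [interior_Ici]
    intro x hx
    have hx : xp + 1 < x := hx
    obtain ⟨-, h0, h1⟩ := hode x (by linarith) (by linarith)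
    have hWx : c ≤ W x := (hW (by simp) (by simp; linarith) hx).le
    have hgx : g x ^ 2 ≤ M ^ 2 := by
      have := hM x (by linarith)
      have : 0 ≤ g x := (hgp ▸ by positivity : 0 ≤ g xp).trans (hmono (by linarith)).le
      gcongr
    refine Real.sqrt_le_iff.2 ⟨h0.le, ?_⟩
    rw [div_le_iff₀ hD0]
    calc c ≤ deriv g x ^ 2 * (1 / 4 * g x ^ 2 + b) := hWx.trans_eq h1.symm
      _ ≤ deriv g x ^ 2 * D := by
        gcongr
        linarith [le_abs_self b]
  have hs : 0 < √(c / D) := Real.sqrt_pos.2 (div_pos hc hD0)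
  set T := (M - g (xp + 1)) / √(c / D) + 1 with hT
  have hMT := hM (xp + 1) (by linarith)
  have hT0 : 0 < T := by
    have := div_nonneg (sub_nonneg.2 hMT) hs.le
    linarith
  have := (convex_Ici (xp + 1)).mul_sub_le_image_sub_of_le_deriv hgc.continuousOn
    (fun x hx => by
      rw [interior_Ici] at hx
      have hx : xp + 1 < x := hx
      exact (hode x (by linarith) (by linarith)).1.differentiableWithinAt) hd
    (xp + 1) self_mem_Ici (xp + 1 + T) (by simpa using hT0.le) (by linarith)
  have h2 := hM (xp + 1 + T) (by linarith)
  have h3 : √(c / D) * T = M - g (xp + 1) + √(c / D) := by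
    rw [hT]; field_simp
  rw [add_sub_cancel_left, h3] at this
  linarith

lemma IsLanger.image_Ioi {W g : ℝ → ℝ} {xm xp b : ℝ} (hg : IsLanger W xm xp b g)
    (hm : xm < xp) (hW : StrictMonoOn W (Ici xp)) (hWp : W xp = 0) :
    g '' Ioi xm = Ioi (-(2 * √(-b))) := by
  have hgm := hg.2.2.2.1
  refine Subset.antisymm ?_ fun y hy => ?_
  · rintro _ ⟨x, hx, rfl⟩
    exact hgm ▸ hg.2.1 hx
  · obtain ⟨x, hx, hyx⟩ := hg.exists_gt hm hW hWp y
    obtain ⟨z, hz, rfl⟩ := intermediate_value_Ioo (hm.trans hx).le hg.1.continuousOn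
      ⟨hgm ▸ hy, hyx⟩
    exact ⟨z, hz.1, rfl⟩

/-- A Langer transformation is smooth away from the left turning point. -/
lemma IsLanger.contDiffOn_Ioi {n : ℕ} (hn : n ≠ 0) {W g : ℝ → ℝ} {xm xp b : ℝ}
    (hg : IsLanger W xm xp b g) (hb : b < 0) (hm : xm < xp)
    (hWC : ContDiffOn ℝ (n + 1) W (Ioi xm)) (hWp : W xp = 0) (hdW : 0 < deriv W xp)
    (hpos : ∀ x, xp < x → 0 < W x) (hneg : ∀ x ∈ Ioo xm xp, W x < 0) :
    ContDiffOn ℝ n g (Ioi xm) := by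
  obtain ⟨hgc, hmono, hgp, hgm, hode⟩ := hg
  obtain ⟨ζ, hζC, hζp, hζ⟩ := exists_airy_variable hn (convex_Ioi xm) isOpen_Ioi hWC hm hWp hdW
    (fun x _ hx => hpos x hx) (fun x h1 h2 => hneg x ⟨h1, h2⟩)
  set r := 2 * √(-b) with hr
  have hr0 : 0 < r := mul_pos two_pos (Real.sqrt_pos.2 (neg_pos.2 hb))
  have hP : ∀ y, 1 / 4 * y ^ 2 + b = 1 / 4 * ((y - r) * (y + r)) := fun y => by
    have := Real.sq_sqrt (neg_pos.2 hb).le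
    linear_combination this + (1 / 4) * (r + 2 * √(-b)) * hr
  obtain ⟨χ, hχC, hχp, hχ⟩ := exists_airy_variable (W := fun y => 1 / 4 * y ^ 2 + b) (p := r) hn
    (convex_Ioi (-r)) isOpen_Ioi (by fun_prop) (by simpa using (by linarith : -r < r))
    ((hP r).trans (by ring))
    (by
      have : HasDerivAt (fun y : ℝ => 1 / 4 * y ^ 2 + b) (1 / 4 * (2 * r)) r := by
        simpa using ((hasDerivAt_pow 2 r).const_mul (1 / 4 : ℝ)).add_const b
      rw [this.deriv]
      positivity)
    (fun y hy hry => by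
      have : -r < y := hy
      rw [hP]
      exact mul_pos (by norm_num) (mul_pos (by linarith) (by linarith)))
    (fun y hy hry => by
      have : -r < y := hy
      rw [hP]
      exact mul_neg_of_pos_of_neg (by norm_num) (mul_neg_of_neg_of_pos (by linarith) (by linarith)))
  have hn0 : (n : WithTop ℕ∞) ≠ 0 := by simpa using hn
  have hmaps : MapsTo g (Ioi xm) (Ioi (-r)) := fun x hx => hgm ▸ hmono hx
  have heq : EqOn (χ ∘ g) ζ (Ioi xm) := by
    refine airy_variable_unique (W := W) (convex_Ioi xm) hm
      (hχC.continuousOn.comp hgc.continuousOn hmaps) hζC.continuousOn (by simp [hgp, hχp]) hζp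
      (fun x _ hx => hpos x hx) (fun x h1 h2 => hneg x ⟨h1, h2⟩) (fun x hx hxp => ?_)
      (fun x hx _ => ⟨deriv ζ x, ((hζC.differentiableOn hn0).differentiableAt
        (isOpen_Ioi.mem_nhds hx)).hasDerivAt, hζ x hx⟩)
    obtain ⟨h1, h2, h3⟩ := hode x (ne_of_gt hx) hxp
    obtain ⟨h4, h5⟩ := hχ (g x) (hmaps hx)
    refine ⟨_, ((hχC.differentiableOn hn0).differentiableAt
      (isOpen_Ioi.mem_nhds (hmaps hx))).hasDerivAt.comp x h1.hasDerivAt, mul_pos h4 h2, ?_⟩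
    rw [← h3, ← h5, Function.comp_apply]
    ring
  intro x hx
  have hx' := isOpen_Ioi.mem_nhds hx
  exact (contDiffAt_of_comp_eventuallyEq hn0
    (hχC.contDiffAt (isOpen_Ioi.mem_nhds (hmaps hx))) (hχ _ (hmaps hx)).1.ne'
    (hζC.contDiffAt hx') hgc.continuousAt (heq.eventuallyEq_of_mem hx')).contDiffWithinAt

/-- **Smoothness of the Langer transformation at fixed `λ`.**
For each `λ ∈ (0, λ_max]`, the Langer transformation `g(·;λ)` restricted to `(x₋(λ), ∞)`
is of class `C³` and maps this interval onto `(−2√(−b), ∞)`. -/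
theorem langer_smooth (V : ℝ → ℝ → ℝ) (lammax δ pp pm Vp Vm : ℝ)
    (hV : SingleWell V lammax δ pp pm Vp Vm) :
    ∀ lam : ℝ, 0 < lam → lam ≤ lammax →
    ∀ xm xp b : ℝ, ∀ g : ℝ → ℝ,
      xm < 0 → 0 < xp → V xm lam = lam → V xp lam = lam →
      b = bParam (fun x => V x lam - lam) xm xp →
      IsLanger (fun x => V x lam - lam) xm xp b g →
      ContDiffOn ℝ 3 g (Ioi xm) ∧ g '' (Ioi xm) = Ioi (-(2 * Real.sqrt (-b))) := by
  intro lam h0 hle xm xp b g hm hp hVm hVp hb hg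
  have hlam : lam ∈ Icc 0 lammax := ⟨h0.le, hle⟩
  have hC := hV.smooth lam hlam
  obtain ⟨hlt, hmono⟩ := single_well_lt_and_strictMonoOn (hC.differentiable (by norm_num))
    (hV.dV_pos lam hlam) (hV.dV_neg lam hlam) hm hp hVm hVp
  have hmp : xm < xp := hm.trans hp
  have hWmono : StrictMonoOn (fun x => V x lam - lam) (Ici xp) := fun x hx y hy hxy =>
    sub_lt_sub_right (hmono (hp.le.trans hx) (hp.le.trans hy) hxy) _
  have hWp : V xp lam - lam = 0 := sub_eq_zero.2 hVp
  have hb0 : b < 0 := by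
    have hc : Continuous fun x => √(-(V x lam - lam)) := by
      have := hC.continuous
      fun_prop
    rw [hb, bParam]
    exact mul_neg_of_neg_of_pos (neg_neg_of_pos (by positivity))
      (intervalIntegral.intervalIntegral_pos_of_pos_on (hc.intervalIntegrable _ _)
        (fun x hx => Real.sqrt_pos.2 (by linarith [hlt x hx])) hmp)
  refine ⟨?_, hg.image_Ioi hmp hWmono hWp⟩
  refine hg.contDiffOn_Ioi (n := 3) (by norm_num) hb0 hmp
    ((hC.sub contDiff_const).contDiffOn.of_le (by norm_num)) hWp ?_
    (fun x hx => by simpa [hVp] using hWmono self_mem_Ici hx.le hx)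
    (fun x hx => sub_neg.2 (hlt x hx))
  simpa using hV.dV_pos lam hlam xp hp
end

section
/- Suppose 𝒱 satisfies the single-well hypotheses. Then there exist δ > 0, λ₀ > 0 and c > 0 such that g'(x;λ) ≥ c holds for all λ ∈ (0, λ₀] and all x with ½·x₋(λ) < x < δ. -/
open MeasureTheory Set

open Filter Topology

lemma nonpos_of_deriv_nonpos_of_pos {φ : ℝ → ℝ} {p q : ℝ} (hpq : p ≤ q)
    (hc : ContinuousOn φ (Icc p q)) (hp : φ p ≤ 0)
    (hd : ∀ x ∈ Ioo p q, 0 < φ x → DifferentiableAt ℝ φ x ∧ deriv φ x ≤ 0) : φ q ≤ 0 := by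
  obtain ⟨s, ⟨hs, hs0⟩, hmax⟩ : ∃ s, IsGreatest (Icc p q ∩ φ ⁻¹' Iic 0) s :=
    (isCompact_Icc.of_isClosed_subset (hc.preimage_isClosed_of_isClosed isClosed_Icc isClosed_Iic)
      inter_subset_left).exists_isGreatest ⟨p, ⟨le_rfl, hpq⟩, hp⟩
  have hpos : ∀ x ∈ Ioo s q, 0 < φ x := fun x hx => by
    by_contra! h
    exact absurd (hmax ⟨⟨hs.1.trans hx.1.le, hx.2.le⟩, h⟩) (not_le.mpr hx.1)
  have hsub : Icc s q ⊆ Icc p q := Icc_subset_Icc_left hs.1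
  have hdiff : ∀ x ∈ Ioo s q, DifferentiableAt ℝ φ x ∧ deriv φ x ≤ 0 := fun x hx =>
    hd x ⟨hs.1.trans_lt hx.1, hx.2⟩ (hpos x hx)
  have hanti : AntitoneOn φ (Icc s q) := by
    refine antitoneOn_of_deriv_nonpos (convex_Icc s q) (hc.mono hsub) ?_ ?_ <;>
      rw [interior_Icc]
    · exact fun x hx => (hdiff x hx).1.differentiableWithinAt
    · exact fun x hx => (hdiff x hx).2
  exact (hanti ⟨le_rfl, hs.2⟩ ⟨hs.2, le_rfl⟩ hs.2).trans hs0

lemma monotoneOn_of_iteratedDeriv_two_nonneg {F : ℝ → ℝ} {r : ℝ} (hF : ContDiff ℝ 2 F)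
    (h0 : deriv F 0 = 0) (h2 : ∀ x ∈ Icc 0 r, 0 ≤ iteratedDeriv 2 F x) :
    MonotoneOn F (Icc 0 r) := by
  have hd : ContDiff ℝ 1 (deriv F) := ((contDiff_succ_iff_deriv (n := 1)).1 hF).2.2
  have h2' : ∀ x, iteratedDeriv 2 F x = deriv (deriv F) x := fun x => by
    rw [iteratedDeriv_succ, iteratedDeriv_one]
  have hm : MonotoneOn (deriv F) (Icc 0 r) := by
    refine monotoneOn_of_deriv_nonneg (convex_Icc 0 r) hd.continuous.continuousOn
      (hd.differentiable (by norm_num)).differentiableOn fun x hx => ?_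
    rw [← h2']
    exact h2 x (interior_subset hx)
  refine monotoneOn_of_deriv_nonneg (convex_Icc 0 r) hF.continuous.continuousOn
    (hF.differentiable (by norm_num)).differentiableOn fun x hx => ?_
  have hx' := interior_subset hx
  rw [← h0]
  exact hm ⟨le_rfl, hx'.1.trans hx'.2⟩ hx' hx'.1

/-- `F` grows on `[0, r]` like a quadratic with second derivative between `a` and `A`. -/
def QuadGrowth (a A r : ℝ) (F : ℝ → ℝ) : Prop :=
  ∀ x y, 0 ≤ x → x ≤ y → y ≤ r →
    a / 2 * (y ^ 2 - x ^ 2) ≤ F y - F x ∧ F y - F x ≤ A / 2 * (y ^ 2 - x ^ 2)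

lemma quadGrowth_of_iteratedDeriv {F : ℝ → ℝ} {a A r : ℝ} (hF : ContDiff ℝ 2 F)
    (h0 : deriv F 0 = 0)
    (h2 : ∀ x ∈ Icc 0 r, a ≤ iteratedDeriv 2 F x ∧ iteratedDeriv 2 F x ≤ A) :
    QuadGrowth a A r F := by
  have hq : ∀ k : ℝ, ContDiff ℝ 2 (fun x : ℝ => k / 2 * x ^ 2) := fun k => by fun_prop
  have hq1 : ∀ k : ℝ, deriv (fun x : ℝ => k / 2 * x ^ 2) = fun x => k * x := fun k => by
    ext x
    have := ((hasDerivAt_pow 2 x).const_mul (k / 2)).deriv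
    rw [this]; push_cast; ring
  have hq2 : ∀ k x : ℝ, iteratedDeriv 2 (fun x : ℝ => k / 2 * x ^ 2) x = k := fun k x => by
    rw [iteratedDeriv_succ, iteratedDeriv_one, hq1]
    simp
  have hdF : Differentiable ℝ F := hF.differentiable (by norm_num)
  have hdq : ∀ k : ℝ, Differentiable ℝ (fun x : ℝ => k / 2 * x ^ 2) := fun k => by fun_prop
  have m1 := monotoneOn_of_iteratedDeriv_two_nonneg (r := r) (hF.sub (hq a))
    (by rw [deriv_fun_sub (hdF 0) (hdq a 0), hq1, h0]; simp)
    (fun x hx => by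
      rw [iteratedDeriv_fun_sub hF.contDiffAt (hq a).contDiffAt, hq2]; linarith [(h2 x hx).1])
  have m2 := monotoneOn_of_iteratedDeriv_two_nonneg (r := r) ((hq A).sub hF)
    (by rw [deriv_fun_sub (hdq A 0) (hdF 0), hq1, h0]; simp)
    (fun x hx => by
      rw [iteratedDeriv_fun_sub (hq A).contDiffAt hF.contDiffAt, hq2]; linarith [(h2 x hx).2])
  intro x y hx hxy hy
  have e1 := m1 ⟨hx, hxy.trans hy⟩ ⟨hx.trans hxy, hy⟩ hxy
  have e2 := m2 ⟨hx, hxy.trans hy⟩ ⟨hx.trans hxy, hy⟩ hxy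
  simp only at e1 e2
  constructor <;> linarith

lemma tendsto_div_of_deriv_sq_mul {u R : ℝ → ℝ} {R0 : ℝ}
    (hR : Tendsto R (𝓝[>] 0) (𝓝 R0)) (hu0 : Tendsto u (𝓝[>] 0) (𝓝 0))
    (hu : ∀ᶠ t in 𝓝[>] (0:ℝ), 0 < u t ∧ DifferentiableAt ℝ u t ∧ 0 < deriv u t ∧
      deriv u t ^ 2 * u t = R t * t) :
    Tendsto (fun t => u t / t) (𝓝[>] 0) (𝓝 (√R0 ^ (2 / 3 : ℝ))) := by
  have hpos : ∀ᶠ t in 𝓝[>] (0:ℝ), 0 < t := eventually_mem_nhdsWithin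
  have key : Tendsto (fun t => u t ^ (3 / 2 : ℝ) / t ^ (3 / 2 : ℝ)) (𝓝[>] 0) (𝓝 √R0) := by
    refine HasDerivAt.lhopital_zero_nhdsGT
      (f' := fun t => deriv u t * (3 / 2) * u t ^ (3 / 2 - 1 : ℝ))
      (g' := fun t => (3 / 2) * t ^ (3 / 2 - 1 : ℝ)) ?_ ?_ ?_ ?_ ?_ ?_
    · filter_upwards [hu] with t ht
      exact ht.2.1.hasDerivAt.rpow_const (Or.inl ht.1.ne')
    · filter_upwards [hpos] with t ht
      exact Real.hasDerivAt_rpow_const (Or.inl ht.ne')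
    · filter_upwards [hpos] with t ht
      positivity
    · have := hu0.rpow_const (p := 3 / 2) (Or.inr (by norm_num))
      rwa [Real.zero_rpow (by norm_num)] at this
    · have := (tendsto_nhdsWithin_of_tendsto_nhds (s := Ioi (0:ℝ))
        (tendsto_id (x := 𝓝 (0:ℝ)))).rpow_const (p := 3 / 2) (Or.inr (by norm_num))
      rwa [Real.zero_rpow (by norm_num)] at this
    · refine ((Real.continuous_sqrt.tendsto R0).comp hR).congr' ?_
      filter_upwards [hu, hpos] with t ⟨h1, _, h3, h4⟩ ht
      have e : (3 / 2 - 1 : ℝ) = 1 / 2 := by norm_num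
      simp only [Function.comp, e, ← Real.sqrt_eq_rpow]
      have : R t = (deriv u t) ^ 2 * u t / t := by field_simp; linarith
      rw [this, Real.sqrt_div (by positivity), Real.sqrt_mul (by positivity), Real.sqrt_sq h3.le]
      have := Real.sqrt_pos.2 ht
      field_simp
  have k2 := key.rpow_const (p := 2 / 3) (Or.inr (by norm_num))
  refine k2.congr' ?_
  filter_upwards [hu, hpos] with t ht h0
  rw [← Real.div_rpow ht.1.le h0.le, ← Real.rpow_mul (div_pos ht.1 h0).le]
  norm_num

lemma IsLanger.differentiableAt_right {W g : ℝ → ℝ} {xm xp b : ℝ} (hxm : xm < xp)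
    (hg : IsLanger W xm xp b g) (hb : b < 0) (hW0 : W xp = 0)
    (hW : DifferentiableAt ℝ W xp) : DifferentiableAt ℝ g xp := by
  obtain ⟨hc, hmono, hgp, hgm, hode⟩ := hg
  set γ := 2 * √(-b) with hγ
  have hγ0 : 0 < γ := by have := Real.sqrt_pos.2 (neg_pos.2 hb); positivity
  have hγ2 : γ ^ 2 = 4 * (-b) := by rw [hγ, mul_pow, Real.sq_sqrt (by linarith)]; norm_num
  have hslope : Tendsto (slope W xp) (𝓝[≠] xp) (𝓝 (deriv W xp)) :=
    hasDerivAt_iff_tendsto_slope.1 hW.hasDerivAt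
  have hRlim : Tendsto (fun x => 4 * slope W xp x / (g x + γ)) (𝓝[≠] xp)
      (𝓝 (4 * deriv W xp / (γ + γ))) := by
    refine (hslope.const_mul 4).div ?_ (by positivity)
    rw [← hgp]
    exact ((hc.tendsto xp).mono_left nhdsWithin_le_nhds).add_const _
  have hp1 : Tendsto (fun t : ℝ => xp + t) (𝓝[>] 0) (𝓝[>] xp) := by
    have := (by fun_prop : ContinuousWithinAt (fun t : ℝ => xp + t) (Ioi 0) 0).tendsto_nhdsWithin
      (t := Ioi xp) (fun t ht => by simpa using ht)
    simpa using this
  have hm1 : Tendsto (fun t : ℝ => xp - t) (𝓝[>] 0) (𝓝[<] xp) := by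
    have := (by fun_prop : ContinuousWithinAt (fun t : ℝ => xp - t) (Ioi 0) 0).tendsto_nhdsWithin
      (t := Iio xp) (fun t ht => by simpa using ht)
    simpa using this
  have hsR : 𝓝[>] xp ≤ 𝓝[≠] xp := nhdsWithin_mono _ fun x hx => ne_of_gt hx
  have hsL : 𝓝[<] xp ≤ 𝓝[≠] xp := nhdsWithin_mono _ fun x hx => ne_of_lt hx
  have hgl : Tendsto g (𝓝 xp) (𝓝 γ) := by rw [← hgp]; exact hc.tendsto xp
  have right := tendsto_div_of_deriv_sq_mul (u := fun t => g (xp + t) - γ)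
    ((hRlim.mono_left hsR).comp hp1)
    (by simpa using ((hgl.mono_left nhdsWithin_le_nhds).comp hp1).sub_const γ)
    (by
      filter_upwards [self_mem_nhdsWithin] with t ht
      replace ht : 0 < t := ht
      obtain ⟨d1, d2, d3⟩ := hode (xp + t) (by linarith) (by linarith)
      have hder : HasDerivAt (fun t => g (xp + t) - γ) (deriv g (xp + t)) t := by
        simpa using (d1.hasDerivAt.comp_const_add xp t).sub_const γ
      have hlt : γ < g (xp + t) := by rw [← hgp]; exact hmono (by linarith)
      refine ⟨by linarith, hder.differentiableAt, by rwa [hder.deriv], ?_⟩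
      rw [hder.deriv]
      simp only [Function.comp, slope_def_field, hW0, add_sub_cancel_left, sub_zero]
      have : g (xp + t) + γ ≠ 0 := by linarith
      rw [← d3]
      field_simp
      linear_combination -hγ2)
  have left := tendsto_div_of_deriv_sq_mul (u := fun t => γ - g (xp - t))
    ((hRlim.mono_left hsL).comp hm1)
    (by simpa using ((hgl.mono_left nhdsWithin_le_nhds).comp hm1).const_sub γ)
    (by
      have h0 : ∀ᶠ t in 𝓝[>] (0:ℝ), t < xp - xm :=
        nhdsWithin_le_nhds (Iio_mem_nhds (by linarith))
      filter_upwards [self_mem_nhdsWithin, h0] with t ht ht2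
      replace ht : 0 < t := ht
      obtain ⟨d1, d2, d3⟩ := hode (xp - t) (by linarith) (by linarith)
      have hder : HasDerivAt (fun t => γ - g (xp - t)) (deriv g (xp - t)) t := by
        simpa using (d1.hasDerivAt.comp_const_sub xp t).const_sub γ
      have hlt : g (xp - t) < γ := by rw [← hgp]; exact hmono (by linarith)
      have hlt2 : -γ < g (xp - t) := by rw [← hgm]; exact hmono (by linarith)
      refine ⟨by linarith, hder.differentiableAt, by rwa [hder.deriv], ?_⟩
      rw [hder.deriv]
      simp only [Function.comp, slope_def_field, hW0, sub_sub_cancel_left, sub_zero]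
      have : g (xp - t) + γ ≠ 0 := by linarith
      rw [← d3]
      field_simp
      linear_combination hγ2)
  set L := √(4 * deriv W xp / (γ + γ)) ^ (2 / 3 : ℝ)
  have hp2 : Tendsto (fun x : ℝ => x - xp) (𝓝[>] xp) (𝓝[>] 0) := by
    have := (by fun_prop : ContinuousWithinAt (fun x : ℝ => x - xp) (Ioi xp) xp).tendsto_nhdsWithin
      (t := Ioi 0) (fun t ht => by simpa using ht)
    simpa using this
  have hm2 : Tendsto (fun x : ℝ => xp - x) (𝓝[<] xp) (𝓝[>] 0) := by
    have := (by fun_prop : ContinuousWithinAt (fun x : ℝ => xp - x) (Iio xp) xp).tendsto_nhdsWithin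
      (t := Ioi 0) (fun t ht => by simpa using ht)
    simpa using this
  have : HasDerivAt g L xp := by
    rw [hasDerivAt_iff_tendsto_slope, ← Iio_union_Ioi, nhdsWithin_union]
    refine Tendsto.sup ?_ ?_
    · refine (left.comp hm2).congr fun x => ?_
      simp only [Function.comp, slope_def_field, hgp, sub_sub_cancel]
      rw [← neg_sub (g x), ← neg_sub x, neg_div_neg_eq]
    · refine (right.comp hp2).congr fun x => ?_
      simp only [Function.comp, slope_def_field, hgp, add_sub_cancel]
  exact this.differentiableAt

lemma bParam_bounds {f : ℝ → ℝ} {a A r lam xm xp : ℝ} (ha : 0 < a) (hf : Continuous f)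
    (hp : QuadGrowth a A r f) (hm : QuadGrowth a A r fun x => f (-x)) (hf0 : f 0 = 0)
    (hxm : xm < 0) (hxp : 0 < xp) (hxmr : -r < xm) (hxpr : xp < r)
    (hfm : f xm = lam) (hfp : f xp = lam) :
    √(3 * a / 8) / (2 * Real.pi) * xp ^ 2 ≤ -bParam (fun x => f x - lam) xm xp ∧
    -bParam (fun x => f x - lam) xm xp ≤ √lam / Real.pi * (xp - xm) := by
  have hπ := Real.pi_pos
  have hnn : ∀ x ∈ Icc xm xp, 0 ≤ f x ∧ f x ≤ lam := by
    intro x hx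
    rcases le_total 0 x with h | h
    · have h1 := (hp 0 x le_rfl h (hx.2.trans hxpr.le)).1
      have h2 := (hp x xp h hx.2 hxpr.le).1
      have : 0 ≤ a / 2 * (x ^ 2 - 0 ^ 2) := by
        rw [zero_pow two_ne_zero, sub_zero]; positivity
      have : x ^ 2 ≤ xp ^ 2 := by gcongr; exact hx.2
      have : 0 ≤ a / 2 * (xp ^ 2 - x ^ 2) := mul_nonneg (by positivity) (by linarith)
      constructor <;> linarith
    · have h1 := (hm 0 (-x) le_rfl (by linarith) (by linarith [hx.1])).1
      have h2 := (hm (-x) (-xm) (by linarith) (by linarith [hx.1]) (by linarith)).1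
      simp only [neg_neg, neg_zero, neg_sq] at h1 h2
      have : 0 ≤ a / 2 * (x ^ 2 - 0 ^ 2) := by
        rw [zero_pow two_ne_zero, sub_zero]; positivity
      have : x ^ 2 ≤ xm ^ 2 := by nlinarith [hx.1]
      have : 0 ≤ a / 2 * (xm ^ 2 - x ^ 2) := mul_nonneg (by positivity) (by linarith)
      constructor <;> linarith
  have hcont : Continuous fun x => √(-(f x - lam)) := by fun_prop
  have hlow : √(3 * a / 8) * xp * (xp / 2) ≤ ∫ x in xm..xp, √(-(f x - lam)) := by
    calc √(3 * a / 8) * xp * (xp / 2) = ∫ _ in (0:ℝ)..(xp / 2), √(3 * a / 8) * xp := by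
          rw [intervalIntegral.integral_const]; simp; ring
      _ ≤ ∫ x in (0:ℝ)..(xp / 2), √(-(f x - lam)) := by
          refine intervalIntegral.integral_mono_on (by linarith) (by simp)
            (hcont.intervalIntegrable _ _) fun x hx => ?_
          have h1 := (hp x xp hx.1 (by linarith [hx.2]) hxpr.le).1
          refine Real.le_sqrt_of_sq_le ?_
          rw [mul_pow, Real.sq_sqrt (by positivity)]
          have : x ^ 2 ≤ (xp / 2) ^ 2 := by have := hx.1; gcongr; exact hx.2
          nlinarith
      _ ≤ ∫ x in xm..xp, √(-(f x - lam)) :=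
          intervalIntegral.integral_mono_interval hxm.le (by linarith) (by linarith)
            (.of_forall fun x => Real.sqrt_nonneg _) (hcont.intervalIntegrable _ _)
  have hup : ∫ x in xm..xp, √(-(f x - lam)) ≤ √lam * (xp - xm) := by
    calc ∫ x in xm..xp, √(-(f x - lam)) ≤ ∫ _ in xm..xp, √lam := by
          refine intervalIntegral.integral_mono_on (by linarith)
            (hcont.intervalIntegrable _ _) (by simp) fun x hx => ?_
          exact Real.sqrt_le_sqrt (by linarith [(hnn x hx).1])
      _ = √lam * (xp - xm) := by rw [intervalIntegral.integral_const]; simp; ring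
  have e : -bParam (fun x => f x - lam) xm xp
      = (1 / Real.pi) * ∫ x in xm..xp, √(-(f x - lam)) := by
    simp only [bParam]; ring
  rw [e]
  constructor
  · calc _ = 1 / Real.pi * (√(3 * a / 8) * xp * (xp / 2)) := by field_simp
      _ ≤ _ := by gcongr
  · calc _ ≤ 1 / Real.pi * (√lam * (xp - xm)) := by gcongr
      _ = _ := by ring

/-- The half-width `2√(-b)` of the Langer well is comparable to the turning points. -/
lemma exists_turning_bounds {a A : ℝ} (ha : 0 < a) (haA : a ≤ A) :
    ∃ k > (0:ℝ), ∃ K > (0:ℝ), ∀ (f : ℝ → ℝ) (r lam xm xp : ℝ), Continuous f →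
      QuadGrowth a A r f → QuadGrowth a A r (fun x => f (-x)) → f 0 = 0 →
      xm < 0 → 0 < xp → -r < xm → xp < r → 0 < lam → f xm = lam → f xp = lam →
      bParam (fun x => f x - lam) xm xp < 0 ∧
      k * xp ≤ 2 * √(-bParam (fun x => f x - lam) xm xp) ∧
      2 * √(-bParam (fun x => f x - lam) xm xp) ≤ K * xp ∧
      2 * √(-bParam (fun x => f x - lam) xm xp) ≤ K * (-xm) := by
  have hπ := Real.pi_pos
  have hA : 0 < A := ha.trans_le haA
  set k0 := √(3 * a / 8) / (2 * Real.pi) with hk0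
  have hk0p : 0 < k0 := by positivity
  set s := √(2 / a) with hs
  set K0 := A * s / Real.pi with hK0
  have hK0p : 0 < K0 := by positivity
  refine ⟨2 * √k0, by positivity, 2 * √K0, by positivity, ?_⟩
  intro f r lam xm xp hf hp hm hf0 hxm hxp hxmr hxpr hl hfm hfp
  obtain ⟨h1, h2⟩ := bParam_bounds ha hf hp hm hf0 hxm hxp hxmr hxpr hfm hfp
  set β := -bParam (fun x => f x - lam) xm xp with hβ
  have hβ0 : 0 < β := lt_of_lt_of_le (by positivity) h1
  obtain ⟨p1, p2⟩ := hp 0 xp le_rfl hxp.le hxpr.le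
  obtain ⟨m1, m2⟩ := hm 0 (-xm) le_rfl (by linarith) (by linarith)
  simp only [neg_neg, neg_zero, neg_sq, hf0, hfm, hfp, zero_pow two_ne_zero, sub_zero]
    at p1 p2 m1 m2
  have hsp : xp ≤ s * √lam := by
    rw [hs, ← Real.sqrt_mul (by positivity)]
    apply Real.le_sqrt_of_sq_le
    rw [div_mul_eq_mul_div, le_div_iff₀ ha]; linarith
  have hsm : -xm ≤ s * √lam := by
    rw [hs, ← Real.sqrt_mul (by positivity)]
    apply Real.le_sqrt_of_sq_le
    rw [div_mul_eq_mul_div, le_div_iff₀ ha]; linarith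
  have hβl : β ≤ 2 * s / Real.pi * lam := by
    calc β ≤ √lam / Real.pi * (xp - xm) := h2
      _ ≤ √lam / Real.pi * (2 * (s * √lam)) := by gcongr; linarith
      _ = 2 * s / Real.pi * (√lam * √lam) := by ring
      _ = _ := by rw [Real.mul_self_sqrt hl.le]
  have hfin : ∀ y : ℝ, 0 < y → lam ≤ A / 2 * y ^ 2 → 2 * √β ≤ 2 * √K0 * y := by
    intro y hy hly
    rw [mul_assoc]
    gcongr
    apply Real.sqrt_le_iff.2 ⟨by positivity, ?_⟩
    rw [mul_pow, Real.sq_sqrt hK0p.le]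
    calc β ≤ 2 * s / Real.pi * lam := hβl
      _ ≤ 2 * s / Real.pi * (A / 2 * y ^ 2) := by gcongr
      _ = _ := by rw [hK0]; ring
  refine ⟨by linarith, ?_, hfin xp hxp p2, hfin (-xm) (by linarith) (by simpa using m2)⟩
  rw [mul_assoc]
  gcongr
  apply Real.le_sqrt_of_sq_le
  rwa [mul_pow, Real.sq_sqrt hk0p.le]

lemma le_deriv_sq_left {f g : ℝ → ℝ} {a A r lam xm γ K x : ℝ} (ha : 0 < a) (hK : 0 < K)
    (hn : QuadGrowth a A r fun x => f (-x)) (hxmr : -r < xm) (hfm : f xm = lam)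
    (hγ0 : 0 < γ) (hKm : γ ≤ K * (-xm)) (hx : xm / 2 < x) (h0 : x < 0)
    (hgx : deriv g x ^ 2 * (g x ^ 2 - γ ^ 2) = 4 * (f x - lam)) :
    3 * a / (2 * K ^ 2) ≤ deriv g x ^ 2 := by
  have hxm : xm < 0 := by linarith
  have h1 := (hn (-x) (-xm) (by linarith) (by linarith) (by linarith)).1
  simp only [neg_neg, neg_sq, hfm] at h1
  have h2 : 3 / 4 * xm ^ 2 ≤ xm ^ 2 - x ^ 2 := by nlinarith
  have h3 : deriv g x ^ 2 * (γ ^ 2 - g x ^ 2) ≤ deriv g x ^ 2 * (K * (-xm)) ^ 2 := by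
    have : γ ^ 2 ≤ (K * (-xm)) ^ 2 := by gcongr
    gcongr
    linarith [sq_nonneg (g x)]
  have h4 : 2 * a * (3 / 4 * xm ^ 2) ≤ deriv g x ^ 2 * K ^ 2 * xm ^ 2 := by
    have : 2 * a * (3 / 4 * xm ^ 2) ≤ 2 * a * (xm ^ 2 - x ^ 2) := by gcongr
    rw [mul_pow, neg_sq, ← mul_assoc] at h3
    linarith
  have h5 : 3 * a / 2 ≤ deriv g x ^ 2 * K ^ 2 := by
    have : 0 < xm ^ 2 := by nlinarith
    refine le_of_mul_le_mul_right ?_ this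
    linarith
  rw [div_le_iff₀ (by positivity)]; linarith

lemma le_deriv_sq_inside {f g : ℝ → ℝ} {a A r lam xm xp γ C k K x : ℝ} (ha : 0 < a)
    (hA : 0 < A) (hK : 0 < K) (hC0 : 0 < C) (hC3 : 4 * A ≤ C ^ 3 * k)
    (hp : QuadGrowth a A r f) (hxm : xm < 0) (hxpr : xp < r) (hfp : f xp = lam)
    (hγ0 : 0 < γ) (hkγ : k * xp ≤ γ) (hKp : γ ≤ K * xp) (hcont : Continuous g)
    (hmono : StrictMono g) (hgp : g xp = γ)
    (hode : ∀ x, x ≠ xm → x ≠ xp → DifferentiableAt ℝ g x ∧ 0 < deriv g x ∧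
      deriv g x ^ 2 * (g x ^ 2 - γ ^ 2) = 4 * (f x - lam))
    (h0 : 0 ≤ x) (hlt : x < xp) : a / (K * C) ≤ deriv g x ^ 2 := by
  have hxp : 0 < xp := h0.trans_lt hlt
  have hgx := (hode x (by linarith) hlt.ne).2.2
  have hnear : ∀ y, 0 ≤ y → y < xp → 0 ≤ g y → γ - g y ≤ C * (xp - y) := by
    intro y hy0 hyp hgy
    have := nonpos_of_deriv_nonpos_of_pos (φ := fun t => γ - g (xp - t) - C * t)
      (p := 0) (q := xp - y) (by linarith)
      (by fun_prop) (by simp [hgp]) ?_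
    · simp only [sub_sub_cancel] at this
      linarith
    intro t ht hpos
    obtain ⟨d1, d2, d3⟩ := hode (xp - t) (by linarith [ht.2]) (by linarith [ht.1])
    have hder : HasDerivAt (fun t => γ - g (xp - t) - C * t) (deriv g (xp - t) - C) t := by
      simpa using! ((d1.hasDerivAt.comp_const_sub xp t).const_sub γ).sub
        ((hasDerivAt_id t).const_mul C)
    refine ⟨hder.differentiableAt, ?_⟩
    rw [hder.deriv, sub_nonpos]
    have hgt : 0 ≤ g (xp - t) := hgy.trans (hmono.monotone (by linarith [ht.2]))
    have hw := (hp (xp - t) xp (by linarith [ht.2]) (by linarith [ht.1]) hxpr.le).2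
    rw [hfp] at hw
    set d := deriv g (xp - t)
    have ht0 : 0 < t := ht.1
    have e1 : d ^ 2 * (C * t * γ) ≤ d ^ 2 * (γ ^ 2 - g (xp - t) ^ 2) := by
      have : C * t * γ ≤ (γ - g (xp - t)) * (γ + g (xp - t)) :=
        mul_le_mul (by linarith) (by linarith) hγ0.le (by nlinarith)
      gcongr
      linarith
    have e2 : xp ^ 2 - (xp - t) ^ 2 ≤ 2 * xp * t := by nlinarith
    have e3 : d ^ 2 * (C * t * γ) ≤ 4 * A * xp * t := by
      have : A / 2 * (xp ^ 2 - (xp - t) ^ 2) ≤ A / 2 * (2 * xp * t) := by gcongr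
      linarith
    have e4 : 4 * A * xp * t ≤ C ^ 2 * (C * t * γ) := by
      calc 4 * A * xp * t ≤ C ^ 3 * k * xp * t := by gcongr
        _ = C ^ 3 * t * (k * xp) := by ring
        _ ≤ C ^ 3 * t * γ := by gcongr
        _ = _ := by ring
    exact le_of_sq_le_sq (le_of_mul_le_mul_right (e3.trans e4) (by positivity)) hC0.le
  have hall : γ ^ 2 - g x ^ 2 ≤ 2 * γ * (C * (xp - x)) := by
    have hxγ : g x < γ := by rw [← hgp]; exact hmono hlt
    rcases le_or_gt 0 (g x) with h | h
    · have := hnear x h0 hlt h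
      calc γ ^ 2 - g x ^ 2 = (γ + g x) * (γ - g x) := by ring
        _ ≤ (2 * γ) * (C * (xp - x)) := by
          apply mul_le_mul <;> linarith
    · obtain ⟨z, hz, hgz⟩ : ∃ z ∈ Icc x xp, g z = 0 :=
        intermediate_value_Icc hlt.le hcont.continuousOn ⟨h.le, by rw [hgp]; exact hγ0.le⟩
      have hzp : z < xp := lt_of_le_of_ne hz.2 (by rintro rfl; linarith)
      have := hnear z (h0.trans hz.1) hzp hgz.ge
      rw [hgz, sub_zero] at this
      have h5 : γ ≤ C * (xp - x) := this.trans (by gcongr; exact hz.1)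
      nlinarith [sq_nonneg (g x)]
  have hw := (hp x xp h0 hlt.le hxpr.le).1
  rw [hfp] at hw
  have hd : 0 < xp - x := by linarith
  have e1 : 2 * a * (xp * (xp - x)) ≤ deriv g x ^ 2 * (2 * (K * xp) * (C * (xp - x))) := by
    calc 2 * a * (xp * (xp - x)) ≤ 2 * a * (xp ^ 2 - x ^ 2) := by
          gcongr
          nlinarith
      _ ≤ deriv g x ^ 2 * (γ ^ 2 - g x ^ 2) := by linarith
      _ ≤ deriv g x ^ 2 * (2 * γ * (C * (xp - x))) := by gcongr
      _ ≤ _ := by gcongr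
  have e2 : a ≤ deriv g x ^ 2 * (K * C) := by
    have : 0 < 2 * (xp * (xp - x)) := by positivity
    refine le_of_mul_le_mul_right ?_ this
    linarith
  rwa [div_le_iff₀ (by positivity)]

lemma le_deriv_sq_outside {f g : ℝ → ℝ} {a A r lam xm xp γ C k K x : ℝ}
    (hK : 0 < K) (hC0 : 0 < C) (hC4 : 2 * A ≤ C ^ 4) (hC3 : 4 * A ≤ C ^ 3 * k)
    (hp : QuadGrowth a A r f) (hxm : xm < 0) (hxp : 0 < xp) (hfp : f xp = lam)
    (hγ0 : 0 < γ) (hkγ : k * xp ≤ γ) (hKp : γ ≤ K * xp) (hcont : Continuous g)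
    (hmono : StrictMono g) (hgp : g xp = γ)
    (hode : ∀ x, x ≠ xm → x ≠ xp → DifferentiableAt ℝ g x ∧ 0 < deriv g x ∧
      deriv g x ^ 2 * (g x ^ 2 - γ ^ 2) = 4 * (f x - lam))
    (hgt : xp < x) (hxr : x < r) : 2 * a / (C * (C + 2 * K)) ≤ deriv g x ^ 2 := by
  have hgx := (hode x (by linarith) hgt.ne').2.2
  have hnear : g x - γ ≤ C * (x - xp) := by
    have := nonpos_of_deriv_nonpos_of_pos (φ := fun t => g t - γ - C * (t - xp))
      (p := xp) (q := x) hgt.le (by fun_prop) (by simp [hgp]) ?_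
    · linarith
    intro t ht hpos
    obtain ⟨d1, d2, d3⟩ := hode t (by linarith [ht.1]) (by linarith [ht.1])
    have hder : HasDerivAt (fun t => g t - γ - C * (t - xp)) (deriv g t - C) t := by
      simpa using (d1.hasDerivAt.sub_const γ).fun_sub
        (((hasDerivAt_id' t).sub_const xp).const_mul C)
    refine ⟨hder.differentiableAt, ?_⟩
    rw [hder.deriv, sub_nonpos]
    have hw := (hp xp t hxp.le ht.1.le (by linarith [ht.2])).2
    rw [hfp] at hw
    set d := deriv g t
    have hs : 0 < t - xp := by linarith [ht.1]
    have e1 : d ^ 2 * (C * (t - xp) * (C * (t - xp) + 2 * γ)) ≤ 2 * A * (t ^ 2 - xp ^ 2) := by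
      calc d ^ 2 * (C * (t - xp) * (C * (t - xp) + 2 * γ))
          ≤ d ^ 2 * ((g t - γ) * (g t + γ)) := by
            have : 0 ≤ C * (t - xp) := by positivity
            refine mul_le_mul_of_nonneg_left ?_ (sq_nonneg d)
            apply mul_le_mul <;> linarith
        _ = d ^ 2 * (g t ^ 2 - γ ^ 2) := by ring
        _ ≤ _ := by linarith
    have e2 : 2 * A * (t ^ 2 - xp ^ 2) ≤ C ^ 2 * (C * (t - xp) * (C * (t - xp) + 2 * γ)) := by
      calc 2 * A * (t ^ 2 - xp ^ 2)
          = (t - xp) * (2 * A * (t - xp) + 4 * A * xp) := by ring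
        _ ≤ (t - xp) * (C ^ 4 * (t - xp) + C ^ 3 * k * xp) := by gcongr
        _ = (t - xp) * (C ^ 4 * (t - xp) + C ^ 3 * (k * xp)) := by ring
        _ ≤ (t - xp) * (C ^ 4 * (t - xp) + C ^ 3 * (2 * γ)) := by
            have : k * xp ≤ 2 * γ := by linarith
            gcongr
        _ = _ := by ring
    exact le_of_sq_le_sq (le_of_mul_le_mul_right (e1.trans e2) (by positivity)) hC0.le
  have hxγ : γ < g x := by rw [← hgp]; exact hmono hgt
  have hw := (hp xp x hxp.le hgt.le hxr.le).1
  rw [hfp] at hw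
  have hd : 0 < x - xp := by linarith
  have e1 : 2 * a * ((x - xp) * (x + xp))
      ≤ deriv g x ^ 2 * (C * (x - xp) * ((C + 2 * K) * (x + xp))) := by
    calc 2 * a * ((x - xp) * (x + xp)) = 4 * (a / 2 * (x ^ 2 - xp ^ 2)) := by ring
      _ ≤ deriv g x ^ 2 * (g x ^ 2 - γ ^ 2) := by linarith
      _ = deriv g x ^ 2 * ((g x - γ) * (g x + γ)) := by ring
      _ ≤ deriv g x ^ 2 * (C * (x - xp) * (C * (x - xp) + 2 * (K * xp))) := by
          have : 0 ≤ C * (x - xp) := by positivity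
          refine mul_le_mul_of_nonneg_left ?_ (sq_nonneg _)
          apply mul_le_mul <;> linarith
      _ ≤ _ := by
          gcongr
          nlinarith [mul_pos hC0 hxp, mul_pos hK hxp, mul_pos hK (hxp.trans hgt)]
  have e2 : 2 * a ≤ deriv g x ^ 2 * (C * (C + 2 * K)) := by
    have : 0 < (x - xp) * (x + xp) := mul_pos hd (by linarith)
    refine le_of_mul_le_mul_right ?_ this
    linarith
  rwa [div_le_iff₀ (by positivity)]

lemma IsLanger.exists_le_deriv {a A k K : ℝ} (ha : 0 < a) (haA : a ≤ A) (hk : 0 < k)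
    (hK : 0 < K) :
    ∃ c > (0:ℝ), ∀ (f g : ℝ → ℝ) (r lam xm xp b : ℝ),
      QuadGrowth a A r f → QuadGrowth a A r (fun x => f (-x)) →
      xm < 0 → 0 < xp → -r < xm → xp < r → f xm = lam → f xp = lam → b < 0 →
      k * xp ≤ 2 * √(-b) → 2 * √(-b) ≤ K * xp → 2 * √(-b) ≤ K * (-xm) →
      IsLanger (fun x => f x - lam) xm xp b g →
      ∀ x, xm / 2 < x → x < r → x ≠ xp → c ≤ deriv g x := by
  have hA : 0 < A := ha.trans_le haA
  set C := 1 + 2 * A + 4 * A / k with hC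
  have hC1 : 1 ≤ C := by have : 0 ≤ 2 * A + 4 * A / k := by positivity
                         linarith
  have hC0 : 0 < C := by linarith
  have hC4 : 2 * A ≤ C ^ 4 := by
    have : C ^ 1 ≤ C ^ 4 := pow_le_pow_right₀ hC1 (by norm_num)
    have : 0 ≤ 4 * A / k := by positivity
    linarith
  have hC3 : 4 * A ≤ C ^ 3 * k := by
    have h1 : C ^ 1 ≤ C ^ 3 := pow_le_pow_right₀ hC1 (by norm_num)
    have h2 : 4 * A / k ≤ C ^ 3 := by linarith
    rwa [div_le_iff₀ hk] at h2
  set m := min (2 * a / (C * (C + 2 * K))) (min (a / (K * C)) (3 * a / (2 * K ^ 2))) with hm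
  have hm0 : 0 < m := by positivity
  refine ⟨√m, Real.sqrt_pos.2 hm0, ?_⟩
  intro f g r lam xm xp b hp hn hxm hxp hxmr hxpr hfm hfp hb hkγ hKp hKm hg x hx hxr hxne
  obtain ⟨hcont, hmono, hgp, hgm, hode⟩ := hg
  set γ := 2 * √(-b) with hγ
  have hγ0 : 0 < γ := lt_of_lt_of_le (by positivity) hkγ
  have hγ2 : γ ^ 2 = 4 * (-b) := by rw [hγ, mul_pow, Real.sq_sqrt (by linarith)]; norm_num
  have hode' : ∀ x, x ≠ xm → x ≠ xp → DifferentiableAt ℝ g x ∧ 0 < deriv g x ∧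
      deriv g x ^ 2 * (g x ^ 2 - γ ^ 2) = 4 * (f x - lam) := fun x h1 h2 => by
    obtain ⟨d1, d2, d3⟩ := hode x h1 h2
    exact ⟨d1, d2, by rw [← show _ = f x - lam from d3, hγ2]; ring⟩
  obtain ⟨_, hgpos, _⟩ := hode x (by linarith) hxne
  suffices h : m ≤ deriv g x ^ 2 from Real.sqrt_le_iff.2 ⟨hgpos.le, h⟩
  rcases lt_or_ge x 0 with h0 | h0
  · exact ((min_le_right _ _).trans (min_le_right _ _)).trans
      (le_deriv_sq_left ha hK hn hxmr hfm hγ0 hKm hx h0 (hode' x (by linarith) hxne).2.2)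
  rcases lt_or_gt_of_ne hxne with hlt | hgt
  · exact ((min_le_right _ _).trans (min_le_left _ _)).trans
      (le_deriv_sq_inside ha hA hK hC0 hC3 hp hxm hxpr hfp hγ0 hkγ hKp hcont hmono hgp hode' h0 hlt)
  · exact (min_le_left _ _).trans
      (le_deriv_sq_outside hK hC0 hC4 hC3 hp hxm hxp hfp hγ0 hkγ hKp hcont hmono hgp hode' hgt
        hxr)

lemma le_deriv_of_le_deriv_right {g : ℝ → ℝ} {c p r : ℝ} (hpr : p < r)
    (hg : DifferentiableAt ℝ g p) (hcont : Continuous g)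
    (hd : ∀ x ∈ Ioo p r, DifferentiableAt ℝ g x ∧ c ≤ deriv g x) : c ≤ deriv g p := by
  have h := (hasDerivAt_iff_tendsto_slope.1 hg.hasDerivAt).mono_left
    (nhdsWithin_mono p fun x (hx : x ∈ Ioi p) => ne_of_gt hx)
  refine ge_of_tendsto h ?_
  filter_upwards [Ioo_mem_nhdsGT hpr] with x hx
  have := (convex_Icc p r).mul_sub_le_image_sub_of_le_deriv hcont.continuousOn
    (fun y hy => (hd y (by rwa [interior_Icc] at hy)).1.differentiableWithinAt)
    (fun y hy => (hd y (by rwa [interior_Icc] at hy)).2) p ⟨le_rfl, hpr.le⟩ x ⟨hx.1.le, hx.2.le⟩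
    hx.1.le
  rwa [slope_def_field, le_div_iff₀ (sub_pos.2 hx.1)]

lemma SingleWell.exists_quadGrowth {V : ℝ → ℝ → ℝ} {lammax δ pp pm Vp Vm : ℝ}
    (hV : SingleWell V lammax δ pp pm Vp Vm) :
    ∃ a > (0:ℝ), ∃ A ≥ a, ∃ r > (0:ℝ), ∃ lam1 > (0:ℝ), lam1 ≤ lammax ∧
      ∀ lam ∈ Icc (0:ℝ) lam1, QuadGrowth a A r (fun x => V x lam) ∧
        QuadGrowth a A r (fun x => V (-x) lam) := by
  have h0mem : (0:ℝ) ∈ Icc (0:ℝ) lammax := ⟨le_rfl, hV.lammax_pos.le⟩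
  set D := iteratedDeriv 2 (fun x => V x 0) 0 with hD
  have hD0 : 0 < D := hV.d2V_pos 0 h0mem
  have hcont := hV.mixed_cont 0 (by norm_num) 2 (by norm_num)
  simp only [pdermix, iteratedDeriv_zero] at hcont
  have hc0 := hcont (0, 0) ⟨⟨by linarith [hV.delta_pos], hV.delta_pos⟩, h0mem⟩
  have hev := hc0.eventually (Ioo_mem_nhds (half_lt_self hD0) (by linarith : D < 2 * D))
  obtain ⟨ε, hε, hball⟩ := Metric.mem_nhdsWithin_iff.1 hev
  set r := min ε δ / 2 with hr
  have hr0 : 0 < r := by have := hV.delta_pos; positivity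
  have hrε : r < ε := by have := min_le_left ε δ; linarith
  have hrδ : r < δ := by have := min_le_right ε δ; have := hV.delta_pos; linarith
  refine ⟨D / 2, by positivity, 2 * D, by linarith, r, hr0, min (ε / 2) lammax,
    lt_min (by positivity) hV.lammax_pos, min_le_right _ _, fun lam hlam => ?_⟩
  have hmem : lam ∈ Icc (0:ℝ) lammax := ⟨hlam.1, hlam.2.trans (min_le_right _ _)⟩
  have hle : lam ≤ ε / 2 := hlam.2.trans (min_le_left _ _)
  have hsm : ContDiff ℝ 2 (fun x => V x lam) := (hV.smooth lam hmem).of_le (by norm_num)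
  have hbd : ∀ x, |x| ≤ r → D / 2 ≤ iteratedDeriv 2 (fun x => V x lam) x ∧
      iteratedDeriv 2 (fun x => V x lam) x ≤ 2 * D := fun x hx => by
    have hx' := abs_le.1 hx
    have := @hball (x, lam) ⟨by
      rw [Metric.mem_ball, Prod.dist_eq, max_lt_iff]
      simp only [Real.dist_eq, sub_zero]
      exact ⟨by linarith, by rw [abs_of_nonneg hlam.1]; linarith⟩,
      ⟨by linarith, by linarith⟩, hmem⟩
    exact ⟨this.1.le, this.2.le⟩
  refine ⟨quadGrowth_of_iteratedDeriv hsm (hV.dV_zero lam hmem) fun x hx => hbd x ?_,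
    quadGrowth_of_iteratedDeriv (F := fun x => V (-x) lam) (hsm.comp contDiff_neg) ?_ ?_⟩
  · rw [abs_of_nonneg hx.1]; exact hx.2
  · rw [deriv_comp_neg (fun x => V x lam), neg_zero, hV.dV_zero lam hmem, neg_zero]
  · intro x hx
    rw [iteratedDeriv_comp_neg 2 (fun x => V x lam)]
    simpa using hbd (-x) (by rw [abs_neg, abs_of_nonneg hx.1]; exact hx.2)

/-- **Lower bound on g'(x;λ) in the inner region.** -/
theorem langer_deriv_lower_inner (V : ℝ → ℝ → ℝ) (lammax δ pp pm Vp Vm : ℝ)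
    (hV : SingleWell V lammax δ pp pm Vp Vm)
    (xm xp : ℝ → ℝ)
    (hx : ∀ lam : ℝ, 0 < lam → lam ≤ lammax →
      xm lam < 0 ∧ 0 < xp lam ∧ V (xm lam) lam = lam ∧ V (xp lam) lam = lam)
    (g : ℝ → ℝ → ℝ)
    (hg : ∀ lam : ℝ, 0 < lam → lam ≤ lammax →
      IsLanger (fun x => V x lam - lam) (xm lam) (xp lam)
        (bParam (fun x => V x lam - lam) (xm lam) (xp lam)) (fun x => g x lam)) :
    ∃ δ0 > (0:ℝ), ∃ lam0 > (0:ℝ), lam0 ≤ lammax ∧ ∃ c > (0:ℝ),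
      ∀ lam : ℝ, 0 < lam → lam ≤ lam0 →
        ∀ x : ℝ, (xm lam) / 2 < x → x < δ0 →
          c ≤ deriv (fun x' => g x' lam) x := by
  obtain ⟨a, ha, A, haA, r, hr, lam1, hlam1, hlam1max, hquad⟩ := hV.exists_quadGrowth
  obtain ⟨k, hk, K, hK, hturn⟩ := exists_turning_bounds ha haA
  obtain ⟨c, hc, hderiv⟩ := IsLanger.exists_le_deriv ha haA hk hK
  refine ⟨r, hr, min lam1 (a / 4 * r ^ 2), lt_min hlam1 (by positivity),
    (min_le_left _ _).trans hlam1max, c, hc, fun lam hl hle x hxl hxr => ?_⟩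
  have hle1 : lam ≤ lam1 := hle.trans (min_le_left _ _)
  have hlr : lam < a / 2 * r ^ 2 := by
    have h1 : lam ≤ a / 4 * r ^ 2 := hle.trans (min_le_right _ _)
    have h2 : 0 < a / 4 * r ^ 2 := by positivity
    linarith
  have hmem : lam ∈ Icc (0:ℝ) lammax := ⟨hl.le, hle1.trans hlam1max⟩
  obtain ⟨hxm, hxp, hVm, hVp⟩ := hx lam hl hmem.2
  have hL := hg lam hl hmem.2
  obtain ⟨hp, hm⟩ := hquad lam ⟨hl.le, hle1⟩
  have hdiff : Differentiable ℝ (fun x => V x lam) :=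
    (hV.smooth lam hmem).differentiable (by norm_num)
  have hV0 := hV.V_zero lam hmem
  have hxpr : xp lam < r := by
    by_contra! hcon
    have hmono : MonotoneOn (fun x => V x lam) (Ici 0) :=
      monotoneOn_of_deriv_nonneg (convex_Ici 0) hdiff.continuous.continuousOn
        hdiff.differentiableOn fun y hy => (hV.dV_pos lam hmem y (by simpa using hy)).le
    have h1 := hmono hr.le hxp.le hcon
    have h2 := (hp 0 r le_rfl hr.le le_rfl).1
    simp only [hV0, hVp, zero_pow two_ne_zero, sub_zero] at h1 h2
    linarith
  have hxmr : -r < xm lam := by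
    by_contra! hcon
    have hanti : AntitoneOn (fun x => V x lam) (Iic 0) :=
      antitoneOn_of_deriv_nonpos (convex_Iic 0) hdiff.continuous.continuousOn
        hdiff.differentiableOn fun y hy => (hV.dV_neg lam hmem y (by simpa using hy)).le
    have h1 := hanti hxm.le (by simpa using hr.le : -r ∈ Iic 0) hcon
    have h2 := (hm 0 r le_rfl hr.le le_rfl).1
    simp only [neg_zero, hV0, hVm, zero_pow two_ne_zero, sub_zero] at h1 h2
    linarith
  obtain ⟨hb, hkγ, hKp, hKm⟩ := hturn (fun x => V x lam) r lam (xm lam) (xp lam)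
    hdiff.continuous hp hm hV0 hxm hxp hxmr hxpr hl hVm hVp
  have hmain := hderiv (fun x => V x lam) (fun x => g x lam) r lam (xm lam) (xp lam) _
    hp hm hxm hxp hxmr hxpr hVm hVp hb hkγ hKp hKm hL
  rcases eq_or_ne x (xp lam) with rfl | hne
  · refine le_deriv_of_le_deriv_right hxpr
      (hL.differentiableAt_right (by linarith) hb (by simp [hVp])
        ((hdiff _).sub_const lam)) hL.1 fun y hy => ?_
    exact ⟨(hL.2.2.2.2 y (by linarith [hy.1]) hy.1.ne').1,
      hmain y (by linarith [hy.1]) hy.2 hy.1.ne'⟩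
  · exact hmain x hxl hxr hne
end

section
/- Suppose 𝒱 satisfies the single-well hypotheses. Then there exist δ > 0, λ₀ > 0 and C > 0 such that |g''(x;λ)| ≤ C holds for all λ ∈ (0, λ₀] and all x with ½·x₋(λ) < x < δ. -/
open MeasureTheory Set

/-- The action `∫₀ˣ √|1 - σ²| dσ` of the normalized inverted parabola. -/
noncomputable def parabolicAction (x : ℝ) : ℝ := ∫ u in (0:ℝ)..x, Real.sqrt |1 - u ^ 2|

theorem hasDerivAt_parabolicAction (x : ℝ) :
    HasDerivAt parabolicAction (Real.sqrt |1 - x ^ 2|) x := by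
  have hc : Continuous fun u : ℝ => Real.sqrt |1 - u ^ 2| := by fun_prop
  exact (hc.integral_hasStrictDerivAt 0 x).hasDerivAt

theorem strictMono_parabolicAction : StrictMono parabolicAction := by
  intro x y hxy
  have hc : Continuous fun u : ℝ => Real.sqrt |1 - u ^ 2| := by fun_prop
  have hpos : 0 < ∫ u in x..y, Real.sqrt |1 - u ^ 2| := by
    refine intervalIntegral.integral_pos hxy hc.continuousOn (fun u _ => Real.sqrt_nonneg _) ?_
    have key : ∃ c ∈ Icc x y, 1 - c ^ 2 ≠ 0 := by
      by_contra! h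
      have h1 := h x ⟨le_rfl, hxy.le⟩
      have h2 := h y ⟨hxy.le, le_rfl⟩
      have h3 := h ((x + y) / 2) ⟨by linarith, by linarith⟩
      nlinarith [sq_pos_of_pos (sub_pos.2 hxy)]
    obtain ⟨c, hc, hne⟩ := key
    exact ⟨c, hc, Real.sqrt_pos.2 (abs_pos.2 hne)⟩
  have := intervalIntegral.integral_interval_sub_left (hc.intervalIntegrable 0 y)
    (hc.intervalIntegrable (μ := volume) 0 x)
  unfold parabolicAction
  linarith

/-- Error formula for linear interpolation at the nodes `±1`. -/
theorem exists_eq_interpolation_error {w w1 w2 : ℝ → ℝ} (hw : ∀ t, HasDerivAt w (w1 t) t)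
    (hw1 : ∀ t, HasDerivAt w1 (w2 t) t) (hp : w 1 = 0) (hm : w (-1) = 0) {t T : ℝ}
    (ht : -1 < t) (ht1 : t ≠ 1) (hT : 1 < T) (htT : t < T) :
    ∃ ξ ∈ Ioo (-1) T, w t = w2 ξ / 2 * (t ^ 2 - 1) := by
  have hne : t ^ 2 - 1 ≠ 0 := by
    intro h
    have : (t - 1) * (t + 1) = 0 := by linarith
    rcases mul_eq_zero.1 this with h | h
    · exact ht1 (by linarith)
    · linarith
  set k := w t / (t ^ 2 - 1) with hk
  have hwt : w t = k * (t ^ 2 - 1) := by rw [hk]; field_simp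
  have hφ : ∀ u, HasDerivAt (fun u => w u - k * (u ^ 2 - 1)) (w1 u - k * (2 * u)) u := by
    intro u
    have := (hw u).fun_sub ((((hasDerivAt_id u).pow 2).sub_const 1).const_mul k)
    simpa using this
  have hφ1 : ∀ u, HasDerivAt (fun u => w1 u - k * (2 * u)) (w2 u - k * 2) u := by
    intro u
    have := (hw1 u).fun_sub (((hasDerivAt_id u).const_mul 2).const_mul k)
    simpa using this
  have rolle : ∀ a b c : ℝ, a < b → b < c → -1 ≤ a → c < T →
      w a = k * (a ^ 2 - 1) → w b = k * (b ^ 2 - 1) → w c = k * (c ^ 2 - 1) →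
      ∃ ξ ∈ Ioo (-1) T, w2 ξ = k * 2 := by
    intro a b c hab hbc ha hc wa wb wc
    obtain ⟨x, hx, ex⟩ := exists_hasDerivAt_eq_zero hab
      (fun u _ => (hφ u).continuousAt.continuousWithinAt) (by simp [wa, wb]) (fun u _ => hφ u)
    obtain ⟨y, hy, ey⟩ := exists_hasDerivAt_eq_zero hbc
      (fun u _ => (hφ u).continuousAt.continuousWithinAt) (by simp [wb, wc]) (fun u _ => hφ u)
    obtain ⟨z, hz, ez⟩ := exists_hasDerivAt_eq_zero (hx.2.trans hy.1)
      (fun u _ => (hφ1 u).continuousAt.continuousWithinAt) (by simp only [ex, ey])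
      (fun u _ => hφ1 u)
    exact ⟨z, ⟨by linarith [hx.1, hz.1], by linarith [hz.2, hy.2]⟩, by linarith⟩
  have : ∃ ξ ∈ Ioo (-1) T, w2 ξ = k * 2 := by
    rcases lt_or_gt_of_ne ht1 with h | h
    · exact rolle (-1) t 1 ht h le_rfl hT (by rw [hm]; ring) hwt (by rw [hp]; ring)
    · exact rolle (-1) 1 t (by norm_num) h le_rfl htT (by rw [hm]; ring) (by rw [hp]; ring) hwt
  obtain ⟨ξ, hξ, e⟩ := this
  exact ⟨ξ, hξ, by rw [hwt, e]; ring⟩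

theorem nonpos_of_deriv_neg_of_pos {G G' : ℝ → ℝ} {a b : ℝ} (hab : a ≤ b)
    (hc : ContinuousOn G (Icc a b)) (ha : G a ≤ 0)
    (hd : ∀ t ∈ Ioo a b, 0 < G t → HasDerivAt G (G' t) t ∧ G' t < 0) : G b ≤ 0 := by
  have hK : IsCompact (Icc a b ∩ G ⁻¹' Iic 0) :=
    isCompact_Icc.of_isClosed_subset (hc.preimage_isClosed_of_isClosed isClosed_Icc isClosed_Iic)
      inter_subset_left
  obtain ⟨c, ⟨hcI, hc0⟩, hcmax⟩ := hK.exists_isGreatest ⟨a, ⟨le_rfl, hab⟩, ha⟩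
  rcases hcI.2.eq_or_lt with h | h
  · exact h ▸ hc0
  by_contra! hb
  have hpos : ∀ t ∈ Ioo c b, 0 < G t := by
    intro t ht
    by_contra! h0
    exact absurd (hcmax ⟨⟨hcI.1.trans ht.1.le, ht.2.le⟩, h0⟩) (not_le.2 ht.1)
  obtain ⟨ξ, hξ, e⟩ := exists_hasDerivAt_eq_slope G G' h
    (hc.mono (Icc_subset_Icc hcI.1 le_rfl))
    (fun t ht => (hd t ⟨hcI.1.trans_lt ht.1, ht.2⟩ (hpos t ht)).1)
  have hneg := (hd ξ ⟨hcI.1.trans_lt hξ.1, hξ.2⟩ (hpos ξ hξ)).2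
  rw [e] at hneg
  have hc0' : G c ≤ 0 := hc0
  have : 0 < (G b - G c) / (b - c) := div_pos (by linarith) (by linarith)
  linarith

theorem nonpos_of_deriv_pos_of_pos {G G' : ℝ → ℝ} {a b : ℝ} (hab : a ≤ b)
    (hc : ContinuousOn G (Icc a b)) (hb : G b ≤ 0)
    (hd : ∀ t ∈ Ioo a b, 0 < G t → HasDerivAt G (G' t) t ∧ 0 < G' t) : G a ≤ 0 := by
  have := nonpos_of_deriv_neg_of_pos (G := fun t => G (-t)) (G' := fun t => -G' (-t))
    (neg_le_neg hab)
    (hc.comp continuous_neg.continuousOn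
      (fun t ht => ⟨by linarith [ht.2], by linarith [ht.1]⟩)) (by simpa using hb)
    (fun t ht h0 => by
      have h := hd (-t) ⟨by linarith [ht.2], by linarith [ht.1]⟩ h0
      refine ⟨?_, by linarith [h.2]⟩
      have := h.1.comp t (hasDerivAt_neg t)
      simpa [Function.comp_def] using this)
  simpa using this

/-- If the derivative is bounded by `C` off a point `x`, then also at `x`. -/
theorem abs_deriv_le_of_punctured {f : ℝ → ℝ} {x C a b : ℝ} (hC : 0 ≤ C) (ha : a < x)
    (hb : x < b) (hf : ∀ y ∈ Ioo a b, y ≠ x → DifferentiableAt ℝ f y ∧ |deriv f y| ≤ C) :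
    |deriv f x| ≤ C := by
  by_cases hd : DifferentiableAt ℝ f x
  swap
  · simpa [deriv_zero_of_not_differentiableAt hd] using hC
  have hall : ∀ y ∈ Ioo a b, DifferentiableAt ℝ f y := by
    intro y hy
    by_cases h : y = x
    · exact h ▸ hd
    · exact (hf y hy h).1
  refine hd.hasDerivAt.le_of_lip' hC ?_
  filter_upwards [Ioo_mem_nhds ha hb] with y hy
  rw [Real.norm_eq_abs, Real.norm_eq_abs]
  rcases lt_trichotomy y x with h | h | h
  · obtain ⟨c, hc, e⟩ := exists_deriv_eq_slope f h
      (fun z hz => (hall z ⟨hy.1.trans_le hz.1, hz.2.trans_lt hb⟩).continuousAt.continuousWithinAt)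
      (fun z hz => (hall z ⟨hy.1.trans hz.1, hz.2.trans hb⟩).differentiableWithinAt)
    have h2 := (hf c ⟨hy.1.trans hc.1, hc.2.trans hb⟩ hc.2.ne).2
    rw [e, abs_div, div_le_iff₀ (abs_pos.2 (sub_ne_zero.2 h.ne'))] at h2
    rwa [abs_sub_comm, abs_sub_comm y x]
  · simp [h]
  · obtain ⟨c, hc, e⟩ := exists_deriv_eq_slope f h
      (fun z hz => (hall z ⟨ha.trans_le hz.1, hz.2.trans_lt hy.2⟩).continuousAt.continuousWithinAt)
      (fun z hz => (hall z ⟨ha.trans hz.1, hz.2.trans hy.2⟩).differentiableWithinAt)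
    have h2 := (hf c ⟨ha.trans hc.1, hc.2.trans hy.2⟩ hc.1.ne').2
    rwa [e, abs_div, div_le_iff₀ (abs_pos.2 (sub_ne_zero.2 h.ne'))] at h2

theorem hasDerivAt_parabolicAction_comp {s : ℝ → ℝ} {t r v : ℝ} (hs : HasDerivAt s r t)
    (hr : 0 ≤ r) (h : r ^ 2 * (s t ^ 2 - 1) = v) :
    HasDerivAt (fun u => parabolicAction (s u)) (Real.sqrt |v|) t := by
  have h1 := (hasDerivAt_parabolicAction (s t)).comp t hs
  have e : Real.sqrt |1 - s t ^ 2| * r = Real.sqrt |v| := by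
    rw [← h, abs_mul, abs_of_nonneg (sq_nonneg r), Real.sqrt_mul (sq_nonneg r), Real.sqrt_sq hr,
      abs_sub_comm, mul_comm]
  rw [← e]
  exact h1

/-- Comparison principle for two functions that agree at the turning point `1`. -/
theorem le_of_parabolicAction_deriv_le {p q ap aq : ℝ → ℝ} {a b : ℝ} (hp : Continuous p)
    (hq : Continuous q) (h1 : p 1 = q 1)
    (h : ∀ u ∈ Ioo a b, u ≠ 1 → HasDerivAt (fun u => parabolicAction (p u)) (ap u) u ∧
      HasDerivAt (fun u => parabolicAction (q u)) (aq u) u ∧ ap u ≤ aq u)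
    (ha : a < 1) {t : ℝ} (ht : t ∈ Ico a b) :
    (1 < t → p t ≤ q t) ∧ (t < 1 → 1 ≤ b → q t ≤ p t) := by
  have hA : Continuous parabolicAction :=
    continuous_iff_continuousAt.2 fun x => (hasDerivAt_parabolicAction x).continuousAt
  have hcont : Continuous fun u => parabolicAction (q u) - parabolicAction (p u) := by fun_prop
  constructor
  · intro h0
    obtain ⟨c, hc, e⟩ := exists_hasDerivAt_eq_slope _ (fun u => aq u - ap u) h0
      hcont.continuousOn (fun u hu => by
        have := h u ⟨ha.trans hu.1, hu.2.trans ht.2⟩ hu.1.ne'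
        exact this.2.1.fun_sub this.1)
    have h3 := (h c ⟨ha.trans hc.1, hc.2.trans ht.2⟩ hc.1.ne').2.2
    rw [eq_div_iff (by linarith), h1] at e
    have : 0 ≤ (aq c - ap c) * (t - 1) := mul_nonneg (by linarith) (by linarith)
    exact strictMono_parabolicAction.le_iff_le.1 (by linarith)
  · intro h0 hb
    obtain ⟨c, hc, e⟩ := exists_hasDerivAt_eq_slope _ (fun u => aq u - ap u) h0
      hcont.continuousOn (fun u hu => by
        have := h u ⟨ht.1.trans_lt hu.1, hu.2.trans_le hb⟩ hu.2.ne
        exact this.2.1.fun_sub this.1)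
    have h3 := (h c ⟨ht.1.trans_lt hc.1, hc.2.trans_le hb⟩ hc.2.ne).2.2
    rw [eq_div_iff (by linarith), h1] at e
    have : 0 ≤ (aq c - ap c) * (1 - t) := mul_nonneg (by linarith) (by linarith)
    exact strictMono_parabolicAction.le_iff_le.1 (by linarith)

theorem abs_sub_le_of_near_parabola {s κ : ℝ → ℝ} {e T : ℝ} (hc : Continuous s) (h1 : s 1 = 1)
    (hd : ∀ u ∈ Ioo 0 T, u ≠ 1 → DifferentiableAt ℝ s u ∧ 0 < deriv s u ∧
      deriv s u ^ 2 * (s u ^ 2 - 1) = κ u * (u ^ 2 - 1))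
    (hκ : ∀ u ∈ Ioo 0 T, u ≠ 1 → |κ u - 1| ≤ e) (he0 : 0 ≤ e) (he : e ≤ 1 / 100)
    (hT : 1 ≤ T) {t : ℝ} (ht : t ∈ Ico 0 T) : |s t - t| ≤ e * |t - 1| := by
  have hL : ∀ θ u : ℝ, HasDerivAt (fun u => 1 + θ * (u - 1)) θ u := by
    intro θ u
    have := (((hasDerivAt_id u).sub_const 1).const_mul θ).const_add 1
    simpa using this
  have hs : ∀ u ∈ Ioo 0 T, u ≠ 1 →
      HasDerivAt (fun u => parabolicAction (s u)) (Real.sqrt |κ u * (u ^ 2 - 1)|) u :=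
    fun u hu hu1 => hasDerivAt_parabolicAction_comp (hd u hu hu1).1.hasDerivAt
      (hd u hu hu1).2.1.le (hd u hu hu1).2.2
  have hA : ∀ θ : ℝ, 0 ≤ θ → ∀ u, HasDerivAt (fun u => parabolicAction (1 + θ * (u - 1)))
      (Real.sqrt |θ ^ 3 * (1 + u + (θ - 1) * (u - 1)) * (u - 1)|) u := fun θ hθ u =>
    hasDerivAt_parabolicAction_comp (hL θ u) hθ (by ring)
  have hk : ∀ u ∈ Ioo 0 T, κ u * (u ^ 2 - 1) = κ u * (1 + u) * (u - 1) := fun u _ => by ring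
  have hi1 : 1 ≤ (1 + e) ^ 2 * (1 - e) := by nlinarith [pow_nonneg he0 3]
  have hi2 : (1 - e) ^ 2 * (1 + e) ≤ 1 := by nlinarith [pow_nonneg he0 3]
  have up := le_of_parabolicAction_deriv_le (p := s) (q := fun u => 1 + (1 + e) * (u - 1))
    hc (by fun_prop) (by simp [h1])
    (fun u hu hu1 => ⟨hs u hu hu1, hA _ (by linarith) u, by
      refine Real.sqrt_le_sqrt ?_
      have hκu := abs_le.1 (hκ u hu hu1)
      have hu0 : 0 < u := hu.1
      have hb : κ u * (1 + u) ≤ (1 + e) ^ 3 * (1 + u + (1 + e - 1) * (u - 1)) := by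
        have h2 : (1 + u) * (1 - e) ≤ 1 + u + (1 + e - 1) * (u - 1) := by nlinarith
        calc κ u * (1 + u) ≤ (1 + e) * (1 + u) := by gcongr; linarith
          _ ≤ (1 + e) * (1 + u) * ((1 + e) ^ 2 * (1 - e)) :=
            le_mul_of_one_le_right (by positivity) hi1
          _ = (1 + e) ^ 3 * ((1 + u) * (1 - e)) := by ring
          _ ≤ _ := by gcongr
      have h0 : 0 ≤ κ u * (1 + u) := mul_nonneg (by linarith) (by linarith)
      rw [hk u hu, abs_mul, abs_mul _ (u - 1), abs_of_nonneg h0, abs_of_nonneg (h0.trans hb)]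
      gcongr⟩) one_pos ht
  have lo := le_of_parabolicAction_deriv_le (q := s) (p := fun u => 1 + (1 - e) * (u - 1))
    (by fun_prop) hc (by simp [h1])
    (fun u hu hu1 => ⟨hA _ (by linarith) u, hs u hu hu1, by
      refine Real.sqrt_le_sqrt ?_
      have hκu := abs_le.1 (hκ u hu hu1)
      have hu0 : 0 < u := hu.1
      have h2 : 1 + u + (1 - e - 1) * (u - 1) ≤ (1 + u) * (1 + e) := by nlinarith
      have h3 : 0 ≤ 1 + u + (1 - e - 1) * (u - 1) := by nlinarith
      have hb : (1 - e) ^ 3 * (1 + u + (1 - e - 1) * (u - 1)) ≤ κ u * (1 + u) := by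
        have h4 : 0 ≤ 1 - e := by linarith
        calc _ ≤ (1 - e) ^ 3 * ((1 + u) * (1 + e)) := by gcongr
          _ = (1 - e) * (1 + u) * ((1 - e) ^ 2 * (1 + e)) := by ring
          _ ≤ (1 - e) * (1 + u) := mul_le_of_le_one_right (by positivity) hi2
          _ ≤ _ := by gcongr; linarith
      have h0 : 0 ≤ (1 - e) ^ 3 * (1 + u + (1 - e - 1) * (u - 1)) :=
        mul_nonneg (pow_nonneg (by linarith) 3) h3
      rw [hk u hu, abs_mul, abs_mul _ (u - 1), abs_of_nonneg h0, abs_of_nonneg (h0.trans hb)]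
      gcongr⟩) one_pos ht
  rcases lt_trichotomy t 1 with h | h | h
  · have a1 := up.2 h hT
    have a2 := lo.2 h hT
    rw [abs_of_neg (by linarith : t - 1 < 0), abs_le]
    constructor <;> linarith
  · simp [h, h1]
  · have a1 := up.1 h
    have a2 := lo.1 h
    rw [abs_of_pos (by linarith : 0 < t - 1), abs_le]
    constructor <;> linarith

/-- The Langer equation normalized so that the turning points are `±1`, for a right-hand side
`w` with derivatives `w1`, `w2`. -/
structure NormalizedLanger (s w w1 w2 : ℝ → ℝ) : Prop where
  cont : Continuous s
  mono : StrictMono s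
  one : s 1 = 1
  neg_one : s (-1) = -1
  eqn : ∀ t, t ≠ -1 → t ≠ 1 → DifferentiableAt ℝ s t ∧ 0 < deriv s t ∧
    deriv s t ^ 2 * (s t ^ 2 - 1) = w t
  w_one : w 1 = 0
  w_neg_one : w (-1) = 0
  hasDerivAt_w : ∀ t, HasDerivAt w (w1 t) t
  hasDerivAt_w1 : ∀ t, HasDerivAt w1 (w2 t) t

theorem abs_sub_one_le_of_sq_mul {r k p q e : ℝ} (hr : 0 < r) (he0 : 0 ≤ e) (he : e ≤ 1 / 100)
    (hk : |k - 1| ≤ e) (hp : |p - 1| ≤ e) (hq : |q - 1| ≤ e) (h : r ^ 2 * (p * q) = k) :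
    |r - 1| ≤ 10 * e := by
  rw [abs_le] at *
  have hp0 : 1 - e ≤ p := by linarith
  have hp1 : p ≤ 1 + e := by linarith
  have hq0 : 1 - e ≤ q := by linarith
  have hq1 : q ≤ 1 + e := by linarith
  have l1 : (1 - e) * (1 - e) ≤ p * q := mul_le_mul hp0 hq0 (by linarith) (by linarith)
  have l2 : p * q ≤ (1 + e) * (1 + e) := mul_le_mul hp1 hq1 (by linarith) (by linarith)
  have hpq : 0 ≤ p * q := mul_nonneg (by linarith) (by linarith)
  constructor
  · by_contra! hlt
    have hr' : r ≤ 1 - 10 * e := by linarith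
    have hsq : r ^ 2 ≤ (1 - 10 * e) ^ 2 := by gcongr
    have : r ^ 2 * (p * q) ≤ (1 - 10 * e) ^ 2 * ((1 + e) * (1 + e)) := by gcongr
    nlinarith [pow_nonneg he0 3, pow_nonneg he0 4, mul_nonneg he0 he0]
  · by_contra! hlt
    have hr' : 1 + 10 * e ≤ r := by linarith
    have hsq : (1 + 10 * e) ^ 2 ≤ r ^ 2 := by gcongr
    have h1e : 0 ≤ 1 - e := by linarith
    have : (1 + 10 * e) ^ 2 * ((1 - e) * (1 - e)) ≤ r ^ 2 * (p * q) := by gcongr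
    nlinarith [pow_nonneg he0 3, pow_nonneg he0 4, mul_nonneg he0 he0]
namespace NormalizedLanger

variable {s w w1 w2 : ℝ → ℝ}

theorem exists_sq_mul_eq (h : NormalizedLanger s w w1 w2) :
    ∃ ξ ∈ Ioo (-1 : ℝ) 1, |w ξ| = |ξ ^ 2 - 1| := by
  have hA : Continuous parabolicAction :=
    continuous_iff_continuousAt.2 fun x => (hasDerivAt_parabolicAction x).continuousAt
  have hc := h.cont
  have hcont : Continuous fun u => parabolicAction (s u) - parabolicAction u := by fun_prop
  obtain ⟨ξ, hξ, e⟩ := exists_hasDerivAt_eq_zero (by norm_num : (-1 : ℝ) < 1) hcont.continuousOn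
    (by simp [h.one, h.neg_one]) (fun u hu =>
      (hasDerivAt_parabolicAction_comp (h.eqn u hu.1.ne' hu.2.ne).1.hasDerivAt
        (h.eqn u hu.1.ne' hu.2.ne).2.1.le (h.eqn u hu.1.ne' hu.2.ne).2.2).fun_sub
        (hasDerivAt_parabolicAction u))
  refine ⟨ξ, hξ, ?_⟩
  have := (Real.sqrt_inj (abs_nonneg _) (abs_nonneg _)).1 (sub_eq_zero.1 e)
  rw [this, abs_sub_comm]

/-- If the right-hand side has nearly constant curvature then the solution is close to the identity. -/
theorem near_identity (h : NormalizedLanger s w w1 w2) {a η T e : ℝ} (ha : 0 < a) (hη : 0 ≤ η)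
    (h2 : ∀ t ∈ Ioo (-1) T, |w2 t - 2 * a| ≤ 2 * a * η * (1 + |t|)) (hT : 1 < T)
    (heq : e = 3 * η * (1 + T)) (he : e ≤ 1 / 100) :
    |a - 1| ≤ e ∧ ∀ t ∈ Ioo (-1) T, |w2 t - 2| ≤ 2 * e ∧ |w1 t - 2 * t| ≤ 2 * e * (1 + |t|) ∧
      |w t - (t ^ 2 - 1)| ≤ e * |t ^ 2 - 1| ∧
      (t ≠ 1 → |s t - t| ≤ e * |t - 1| ∧ |deriv s t - 1| ≤ 10 * e) := by
  have hηT : 0 ≤ η * (1 + T) := by positivity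
  have he0 : 0 ≤ e := by rw [heq]; linarith
  have hw2a : ∀ t ∈ Ioo (-1) T, |w2 t - 2 * a| ≤ 2 * a * (e / 3) := by
    intro t ht
    refine (h2 t ht).trans ?_
    have : |t| ≤ T := abs_le.2 ⟨by linarith [ht.1], ht.2.le⟩
    calc 2 * a * η * (1 + |t|) ≤ 2 * a * η * (1 + T) := by gcongr
      _ = 2 * a * (e / 3) := by rw [heq]; ring
  have hκa : ∀ t ∈ Ioo (-1) T, t ≠ 1 → ∃ k, |k - a| ≤ a * (e / 3) ∧ w t = k * (t ^ 2 - 1) := by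
    intro t ht ht1
    obtain ⟨ξ, hξ, hξe⟩ := exists_eq_interpolation_error h.hasDerivAt_w h.hasDerivAt_w1 h.w_one
      h.w_neg_one ht.1 ht1 hT ht.2
    refine ⟨w2 ξ / 2, ?_, hξe⟩
    have := abs_le.1 (hw2a ξ hξ)
    exact abs_le.2 ⟨by linarith [this.1], by linarith [this.2]⟩
  have ha1 : |a - 1| ≤ a * (e / 3) := by
    obtain ⟨ξ, hξ, hξe⟩ := h.exists_sq_mul_eq
    obtain ⟨k, hk, hwk⟩ := hκa ξ ⟨hξ.1, hξ.2.trans hT⟩ hξ.2.ne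
    have hne : |ξ ^ 2 - 1| ≠ 0 := by
      have : ξ ^ 2 - 1 < 0 := by nlinarith [hξ.1, hξ.2]
      exact abs_ne_zero.2 this.ne
    have hk0 : 0 < k := by nlinarith [(abs_le.1 hk).1]
    rw [hwk, abs_mul, mul_eq_right₀ hne, abs_of_pos hk0] at hξe
    rw [abs_sub_comm, ← hξe]
    exact hk
  have ha2 : a ≤ 1.01 := by
    have := (abs_le.1 ha1).2
    nlinarith
  have hae : a * (e / 3) ≤ 1.01 * (e / 3) := by gcongr
  have hκ : ∀ t ∈ Ioo (-1) T, t ≠ 1 → ∃ k, |k - 1| ≤ e ∧ w t = k * (t ^ 2 - 1) := by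
    intro t ht ht1
    obtain ⟨k, hk, hwk⟩ := hκa t ht ht1
    refine ⟨k, ?_, hwk⟩
    have := abs_sub_le k a 1
    linarith
  have hw2 : ∀ t ∈ Ioo (-1) T, |w2 t - 2| ≤ 2 * e := by
    intro t ht
    have h3 := abs_sub_le (w2 t) (2 * a) 2
    have h4 := hw2a t ht
    have h5 : |2 * a - 2| = 2 * |a - 1| := by
      rw [show 2 * a - 2 = 2 * (a - 1) by ring, abs_mul]; norm_num
    linarith
  refine ⟨by linarith, fun t ht => ⟨hw2 t ht, ?_, ?_, ?_⟩⟩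
  · have hφ : ∀ u, HasDerivAt (fun u => w u - (u ^ 2 - 1)) (w1 u - 2 * u) u := by
      intro u
      have := (h.hasDerivAt_w u).fun_sub (((hasDerivAt_id u).pow 2).sub_const 1)
      simpa using this
    have hφ1 : ∀ u, HasDerivAt (fun u => w1 u - 2 * u) (w2 u - 2) u := by
      intro u
      have := (h.hasDerivAt_w1 u).fun_sub ((hasDerivAt_id u).const_mul 2)
      simpa using this
    obtain ⟨z, hz, ez⟩ := exists_hasDerivAt_eq_zero (by norm_num : (-1 : ℝ) < 1)
      (fun u _ => (hφ u).continuousAt.continuousWithinAt) (by simp [h.w_one, h.w_neg_one])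
      (fun u _ => hφ u)
    have hlip := (convex_Ioo (-1 : ℝ) T).norm_image_sub_le_of_norm_hasDerivWithin_le
      (fun u _ => (hφ1 u).hasDerivWithinAt) (fun u hu => hw2 u hu)
      (show z ∈ Ioo (-1) T from ⟨hz.1, hz.2.trans hT⟩) ht
    simp only [Real.norm_eq_abs, ez, sub_zero] at hlip
    refine hlip.trans ?_
    gcongr
    have := abs_sub t z
    have hz1 : |z| ≤ 1 := abs_le.2 ⟨hz.1.le, hz.2.le⟩
    linarith
  · by_cases ht1 : t = 1
    · simp [ht1, h.w_one]
    obtain ⟨k, hk, hwk⟩ := hκ t ht ht1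
    rw [hwk, show k * (t ^ 2 - 1) - (t ^ 2 - 1) = (k - 1) * (t ^ 2 - 1) by ring, abs_mul]
    gcongr
  · intro ht1
    have hquot : ∀ u ∈ Ioo (-1) T, u ≠ 1 → |w u / (u ^ 2 - 1) - 1| ≤ e ∧
        w u = w u / (u ^ 2 - 1) * (u ^ 2 - 1) := by
      intro u hu hu1
      obtain ⟨k, hk, hwk⟩ := hκ u hu hu1
      have hne : u ^ 2 - 1 ≠ 0 := by
        have : (u - 1) * (u + 1) ≠ 0 :=
          mul_ne_zero (sub_ne_zero.2 hu1) (by linarith [hu.1] : 0 < u + 1).ne'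
        intro h0
        exact this (by linarith)
      rw [hwk, mul_div_cancel_right₀ _ hne]
      exact ⟨hk, rfl⟩
    obtain ⟨k, hk, hwk⟩ := hκ t ht ht1
    obtain ⟨-, hr, hrt⟩ := h.eqn t ht.1.ne' ht1
    have htm : t - 1 ≠ 0 := sub_ne_zero.2 ht1
    have htp : 0 < t + 1 := by linarith [ht.1]
    have hmain : |s t - t| ≤ e * |t - 1| ∧ |s t - t| ≤ e * |t + 1| := by
      rcases le_or_gt 0 t with h0 | h0
      · have := abs_sub_le_of_near_parabola (κ := fun u => w u / (u ^ 2 - 1)) h.cont h.one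
          (fun u hu hu1 => by
            have h5 := h.eqn u (by linarith [hu.1] : -1 < u).ne' hu1
            exact ⟨h5.1, h5.2.1, h5.2.2.trans (hquot u ⟨by linarith [hu.1], hu.2⟩ hu1).2⟩)
          (fun u hu hu1 => (hquot u ⟨by linarith [hu.1], hu.2⟩ hu1).1) he0 he hT.le ⟨h0, ht.2⟩
        refine ⟨this, this.trans ?_⟩
        gcongr e * ?_
        rw [abs_of_pos htp, abs_le]
        constructor <;> linarith
      · have := abs_sub_le_of_near_parabola (s := fun u => -s (-u)) (T := 1)
          (κ := fun u => w (-u) / (u ^ 2 - 1)) (h.cont.comp continuous_neg).neg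
          (by simp [h.neg_one])
          (fun u hu hu1 => by
            have h5 := h.eqn (-u) (by linarith [hu.2] : -1 < -u).ne' (by linarith [hu.1] : -u < 1).ne
            have h6 : HasDerivAt (fun u => -s (-u)) (deriv s (-u)) u := by
              have := (h5.1.hasDerivAt.comp u (hasDerivAt_neg u)).fun_neg
              simpa [Function.comp_def] using this
            rw [h6.deriv]
            refine ⟨h6.differentiableAt, h5.2.1, ?_⟩
            have h7 := (hquot (-u) ⟨by linarith [hu.2], by linarith [hu.1]⟩
              (by linarith [hu.1] : -u < 1).ne).2
            simp only [neg_sq] at h7 ⊢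
            rw [h5.2.2]
            exact h7)
          (fun u hu hu1 => by
            have := (hquot (-u) ⟨by linarith [hu.2], by linarith [hu.1]⟩
              (by linarith [hu.1] : -u < 1).ne).1
            simpa only [neg_sq] using this) he0 he le_rfl (t := -t)
          ⟨by linarith, by linarith [ht.1]⟩
        have e1 : |-s (- -t) - -t| = |s t - t| := by
          rw [neg_neg, ← abs_neg]; congr 1; ring
        have e2 : |-t - 1| = |t + 1| := by rw [← abs_neg]; congr 1; ring
        rw [e1, e2] at this
        refine ⟨this.trans ?_, this⟩
        gcongr e * ?_
        rw [abs_of_pos htp, abs_of_neg (by linarith)]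
        linarith
    refine ⟨hmain.1, ?_⟩
    refine abs_sub_one_le_of_sq_mul (k := k) (p := (s t - 1) / (t - 1)) (q := (s t + 1) / (t + 1))
      hr he0 he hk ?_ ?_ ?_
    · rw [div_sub_one htm, abs_div, div_le_iff₀ (abs_pos.2 htm)]
      rw [show s t - 1 - (t - 1) = s t - t by ring]
      exact hmain.1
    · rw [div_sub_one htp.ne', abs_div, div_le_iff₀ (abs_pos.2 htp.ne')]
      rw [show s t + 1 - (t + 1) = s t - t by ring]
      exact hmain.2
    · have hne := htp.ne'
      rw [hwk] at hrt
      field_simp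
      linear_combination hrt

end NormalizedLanger
theorem abs_mul_sub_le {r x t v e : ℝ} (he0 : 0 ≤ e) (he : e ≤ 1 / 1000)
    (hv : |v - 2 * t| ≤ 2 * e * (1 + |t|)) (hx : |x - t| ≤ e * |t - 1|)
    (hr : |r - 1| ≤ 10 * e) : |r * v - 2 * x * r ^ 4| ≤ 70 * e * (1 + |t|) := by
  have hr' := abs_le.1 hr
  have hr0 : 0 ≤ r := by linarith
  have hr1 : r ≤ 1.01 := by linarith
  have hr2 : r ^ 2 ≤ 1.01 ^ 2 := by gcongr
  have hr3 : r ^ 3 ≤ 1.01 ^ 3 := by gcongr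
  have hc : |r ^ 3 - 1| ≤ 31 * e := by
    rw [show r ^ 3 - 1 = (r - 1) * (r ^ 2 + r + 1) by ring, abs_mul,
      abs_of_nonneg (by positivity : 0 ≤ r ^ 2 + r + 1)]
    calc |r - 1| * (r ^ 2 + r + 1) ≤ 10 * e * 3.1 := by gcongr; linarith
      _ = 31 * e := by ring
  have ht1 : |t - 1| ≤ 1 + |t| := by
    have := abs_sub t 1
    rw [abs_one] at this
    linarith
  have ht0 := abs_nonneg t
  have e1 : |(x - t) * r ^ 3| ≤ 1.1 * (e * (1 + |t|)) := by
    rw [abs_mul, abs_of_nonneg (by positivity : 0 ≤ r ^ 3)]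
    calc |x - t| * r ^ 3 ≤ e * (1 + |t|) * 1.1 := by
          gcongr
          · exact hx.trans (by gcongr)
          · linarith
      _ = _ := by ring
  have e2 : |t * (r ^ 3 - 1)| ≤ 31 * (e * (1 + |t|)) := by
    rw [abs_mul]
    calc |t| * |r ^ 3 - 1| ≤ (1 + |t|) * (31 * e) := by gcongr; linarith
      _ = _ := by ring
  have hE : 0 ≤ e * (1 + |t|) := by positivity
  have e3 : |v - 2 * x * r ^ 3| ≤ 67 * (e * (1 + |t|)) := by
    rw [abs_le] at *
    constructor <;> nlinarith
  rw [show r * v - 2 * x * r ^ 4 = r * (v - 2 * x * r ^ 3) by ring, abs_mul, abs_of_nonneg hr0]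
  calc r * |v - 2 * x * r ^ 3| ≤ 1.01 * (67 * (e * (1 + |t|))) := by gcongr
    _ ≤ 70 * e * (1 + |t|) := by linarith

theorem damping_bounds {r x t v v2 e : ℝ} (he0 : 0 ≤ e) (he : e ≤ 1 / 1000)
    (ht : t ∈ Ioo (1 / 2) (3 / 2)) (hv : |v - 2 * t| ≤ 2 * e * (1 + |t|))
    (hv2 : |v2 - 2| ≤ 2 * e) (hx : |x - t| ≤ e * |t - 1|) (hr : |r - 1| ≤ 10 * e) :
    0 ≤ v ∧ |r * v2 - 2 * r ^ 5| ≤ 90 * e ∧ 1 / 2 ≤ 8 * x * r ^ 3 - 3 * v := by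
  have ht0 : 0 < t := by linarith [ht.1]
  have ht2 : t < 3 / 2 := ht.2
  have ht3 : 1 / 2 < t := ht.1
  rw [abs_of_pos ht0] at hv
  have hv5 : 2 * e * (1 + t) ≤ 5 * e := by nlinarith
  have hv' := abs_le.1 (hv.trans hv5)
  have hr' := abs_le.1 hr
  have hr0 : 0 ≤ r := by linarith
  have hr1 : r ≤ 1.01 := by linarith
  have hrl : 0.99 ≤ r := by linarith
  have hr2 : r ^ 2 ≤ 1.01 ^ 2 := by gcongr
  have hr3 : r ^ 3 ≤ 1.01 ^ 3 := by gcongr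
  have hl3 : 0.99 ^ 3 ≤ r ^ 3 := by gcongr
  have ht1 : |t - 1| ≤ 1 / 2 := abs_le.2 ⟨by linarith, by linarith⟩
  have hx' := abs_le.1 (hx.trans (by gcongr : e * |t - 1| ≤ e * (1 / 2)))
  refine ⟨by linarith, ?_, ?_⟩
  · have e1 : |r - 1| * |r ^ 3 + r ^ 2 + r + 1| ≤ 10 * e * 4.2 := by
      rw [abs_of_nonneg (by positivity : 0 ≤ r ^ 3 + r ^ 2 + r + 1)]
      gcongr
      linarith
    rw [show r * v2 - 2 * r ^ 5 = r * ((v2 - 2) - 2 * ((r - 1) * (r ^ 3 + r ^ 2 + r + 1))) by ring,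
      abs_mul, abs_of_nonneg hr0]
    rw [← abs_mul] at e1
    have e2 : |(v2 - 2) - 2 * ((r - 1) * (r ^ 3 + r ^ 2 + r + 1))| ≤ 86 * e := by
      rw [abs_le] at *
      constructor <;> linarith
    calc _ ≤ 1.01 * (86 * e) := by gcongr
      _ ≤ 90 * e := by linarith
  · have hx1 : t - 0.001 ≤ x := by linarith
    have : (t - 0.001) * 0.99 ^ 3 ≤ x * r ^ 3 := by gcongr; linarith
    linarith

namespace NormalizedLanger

variable {s w w1 w2 : ℝ → ℝ}

theorem hasDerivAt_deriv (h : NormalizedLanger s w w1 w2) {t : ℝ} (htm : t ≠ -1) (ht1 : t ≠ 1) :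
    HasDerivAt (deriv s) (deriv (deriv s) t) t ∧
      2 * w t * deriv (deriv s) t = deriv s t * w1 t - 2 * s t * deriv s t ^ 4 := by
  have hev : ∀ᶠ u in nhds t, u ≠ -1 ∧ u ≠ 1 :=
    (isOpen_ne.eventually_mem htm).and (isOpen_ne.eventually_mem ht1)
  have hne : ∀ u, u ≠ -1 → u ≠ 1 → s u ^ 2 - 1 ≠ 0 := by
    intro u hm h1 h0
    rcases mul_eq_zero.1 (by linarith : (s u - 1) * (s u + 1) = 0) with h0 | h0
    · exact h1 (h.mono.injective (by rw [h.one]; linarith))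
    · exact hm (h.mono.injective (by rw [h.neg_one]; linarith))
  have hsq : ∀ u, u ≠ -1 → u ≠ 1 → deriv s u ^ 2 = w u / (s u ^ 2 - 1) := by
    intro u hm h1
    rw [eq_div_iff (hne u hm h1), (h.eqn u hm h1).2.2]
  have hst := (h.eqn t htm ht1).1.hasDerivAt
  have hden : HasDerivAt (fun u => s u ^ 2 - 1) (2 * s t * deriv s t) t := by
    have := (hst.fun_pow 2).sub_const 1
    simpa using this
  have hform : deriv s =ᶠ[nhds t] fun u => Real.sqrt (w u / (s u ^ 2 - 1)) := by
    filter_upwards [hev] with u hu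
    rw [← hsq u hu.1 hu.2, Real.sqrt_sq (h.eqn u hu.1 hu.2).2.1.le]
  have hrt := (h.eqn t htm ht1).2.1
  have hdiff : DifferentiableAt ℝ (deriv s) t := by
    have := (((h.hasDerivAt_w t).fun_div hden (hne t htm ht1)).sqrt
      (by rw [← hsq t htm ht1]; positivity)).differentiableAt
    exact this.congr_of_eventuallyEq hform
  refine ⟨hdiff.hasDerivAt, ?_⟩
  have hprod := (hdiff.hasDerivAt.fun_pow 2).fun_mul hden
  have heq : (fun u => deriv s u ^ 2 * (s u ^ 2 - 1)) =ᶠ[nhds t] w := by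
    filter_upwards [hev] with u hu
    exact (h.eqn u hu.1 hu.2).2.2
  have huniq := hprod.unique ((h.hasDerivAt_w t).congr_of_eventuallyEq heq)
  simp only [Nat.cast_ofNat, Nat.add_one_sub_one, pow_one] at huniq
  rw [← (h.eqn t htm ht1).2.2]
  linear_combination (deriv s t) * huniq

theorem abs_second_deriv_le_of_far (h : NormalizedLanger s w w1 w2) {t e : ℝ} (ht : -1 < t)
    (ht1 : t ≠ 1) (he0 : 0 ≤ e) (he : e ≤ 1 / 1000) (hw1 : |w1 t - 2 * t| ≤ 2 * e * (1 + |t|))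
    (hw : |w t - (t ^ 2 - 1)| ≤ e * |t ^ 2 - 1|) (hs : |s t - t| ≤ e * |t - 1|)
    (hr : |deriv s t - 1| ≤ 10 * e) :
    |deriv (deriv s) t| * |t ^ 2 - 1| ≤ 36 * e * (1 + |t|) := by
  have h1 := abs_mul_sub_le he0 he hw1 hs hr
  rw [← (h.hasDerivAt_deriv ht.ne' ht1).2, abs_mul, abs_mul, abs_two] at h1
  have h2 : 0.999 * |t ^ 2 - 1| ≤ |w t| := by
    have := abs_sub_abs_le_abs_sub (t ^ 2 - 1) (w t)
    rw [abs_sub_comm (t ^ 2 - 1)] at this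
    nlinarith [abs_nonneg (t ^ 2 - 1)]
  have h3 := mul_le_mul_of_nonneg_right h2 (abs_nonneg (deriv (deriv s) t))
  have h4 : 0 ≤ e * (1 + |t|) := by positivity
  linarith

/-- Near the turning point the second derivative solves a singular first-order linear equation,
and the damping towards the turning point bounds it by the forcing. -/
theorem mul_second_deriv_le_of_near (h : NormalizedLanger s w w1 w2) {T e σ : ℝ} (hσ : |σ| = 1)
    (he0 : 0 ≤ e) (he : e ≤ 1 / 1000) (hT : 1 < T)
    (hest : ∀ t ∈ Ioo (-1) T, |w2 t - 2| ≤ 2 * e ∧ |w1 t - 2 * t| ≤ 2 * e * (1 + |t|) ∧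
      |w t - (t ^ 2 - 1)| ≤ e * |t ^ 2 - 1| ∧
      (t ≠ 1 → |s t - t| ≤ e * |t - 1| ∧ |deriv s t - 1| ≤ 10 * e))
    {t : ℝ} (ht : t ∈ Ioo (1 / 2) (3 / 2)) (htT : t < T) (ht1 : t ≠ 1) :
    σ * deriv (deriv s) t ≤ 180 * e := by
  set N : ℝ → ℝ := fun u => deriv s u * w1 u - 2 * s u * deriv s u ^ 4 with hN
  set G : ℝ → ℝ := fun u => σ * (w u * N u) - 2 * (180 * e) * w u ^ 2 with hG
  set S := deriv (deriv s) with hS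
  set B : ℝ → ℝ := fun u => σ * (deriv s u * w2 u - 2 * deriv s u ^ 5 -
    (8 * s u * deriv s u ^ 3 - 3 * w1 u) * S u) - 4 * (180 * e) * w1 u with hB
  have hGS : ∀ u, u ≠ -1 → u ≠ 1 → G u = 2 * w u ^ 2 * (σ * S u - 180 * e) := by
    intro u hm h1
    simp only [hG, hN]
    rw [← (h.hasDerivAt_deriv hm h1).2]
    ring
  have hGd : ∀ u, u ≠ -1 → u ≠ 1 → HasDerivAt G (w u * B u) u := by
    intro u hm h1
    obtain ⟨hSd, hSe⟩ := h.hasDerivAt_deriv hm h1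
    have hsd := (h.eqn u hm h1).1.hasDerivAt
    have hNd : HasDerivAt N (S u * w1 u + deriv s u * w2 u -
        (2 * deriv s u * deriv s u ^ 4 + 2 * s u * (4 * deriv s u ^ 3 * S u))) u := by
      have := (hSd.fun_mul (h.hasDerivAt_w1 u)).fun_sub ((hsd.const_mul 2).fun_mul (hSd.fun_pow 4))
      simpa using this
    have hd := (((h.hasDerivAt_w u).fun_mul hNd).const_mul σ).fun_sub
      (((h.hasDerivAt_w u).fun_pow 2).const_mul (2 * (180 * e)))
    have hNu : N u = 2 * w u * S u := hSe.symm
    refine hd.congr_deriv ?_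
    rw [hNu]
    simp only [hB]
    push_cast
    ring
  have hBneg : ∀ u ∈ Ioo (1 / 2) (3 / 2), u < T → u ≠ 1 → 0 < G u → B u < 0 := by
    intro u hu huT hu1 hpos
    have hm : -1 < u := by linarith [hu.1]
    obtain ⟨e1, e2, -, e4⟩ := hest u ⟨hm, huT⟩
    obtain ⟨d1, d2, d3⟩ := damping_bounds he0 he hu e2 e1 (e4 hu1).1 (e4 hu1).2
    rw [hGS u hm.ne' hu1] at hpos
    have hSpos : 0 < σ * S u - 180 * e := pos_of_mul_pos_right hpos (by positivity)
    have hf : σ * (deriv s u * w2 u - 2 * deriv s u ^ 5) ≤ 90 * e := by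
      refine (le_abs_self _).trans ?_
      rw [abs_mul, hσ, one_mul]
      exact d2
    have hμ : 90 * e < (8 * s u * deriv s u ^ 3 - 3 * w1 u) * (σ * S u) := by nlinarith
    have hw : 0 ≤ e * w1 u := mul_nonneg he0 d1
    simp only [hB]
    linarith
  have hcont1 : ContinuousAt G 1 := by
    have hwc : ContinuousAt w 1 := (h.hasDerivAt_w 1).continuousAt
    have hY : ContinuousAt (fun u => w u * N u) 1 := by
      have hlim : Filter.Tendsto (fun u => |w u| * (70 * e * 3)) (nhds 1) (nhds 0) := by
        have := (hwc.abs.mul_const (70 * e * 3)).tendsto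
        simpa [h.w_one] using this
      have : Filter.Tendsto (fun u => w u * N u) (nhds 1) (nhds 0) := by
        refine squeeze_zero_norm' ?_ hlim
        have hlt : (1 : ℝ) < min T 2 := lt_min hT (by norm_num)
        filter_upwards [Ioo_mem_nhds (by norm_num : (0 : ℝ) < 1) hlt] with u hu
        rw [Real.norm_eq_abs, abs_mul]
        by_cases hu1 : u = 1
        · simp [hu1, h.w_one]
        obtain ⟨-, e2, -, e4⟩ := hest u ⟨by linarith [hu.1], hu.2.trans_le (min_le_left _ _)⟩
        have hu2 : u < 2 := hu.2.trans_le (min_le_right _ _)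
        gcongr
        refine (abs_mul_sub_le he0 he e2 (e4 hu1).1 (e4 hu1).2).trans ?_
        gcongr
        rw [abs_of_pos hu.1]
        linarith
      rw [ContinuousAt]
      simpa [h.w_one] using this
    exact (hY.const_mul σ).sub ((hwc.pow 2).const_mul _)
  have hG1 : G 1 ≤ 0 := by simp [hG, h.w_one]
  have hcont : ∀ u, -1 < u → ContinuousWithinAt G (Icc (min t 1) (max t 1)) u := by
    intro u hu
    by_cases hu1 : u = 1
    · subst hu1
      exact hcont1.continuousWithinAt
    · exact (hGd u hu.ne' hu1).continuousAt.continuousWithinAt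
  have htm : -1 < t := by linarith [ht.1]
  have hwsign : ∀ u ∈ Ioo (-1) T, w u - (u ^ 2 - 1) ≤ 0.001 * |u ^ 2 - 1| ∧
      -(0.001 * |u ^ 2 - 1|) ≤ w u - (u ^ 2 - 1) := by
    intro u hu
    have h3 := (hest u hu).2.2.1.trans
      (by gcongr; linarith : e * |u ^ 2 - 1| ≤ 0.001 * |u ^ 2 - 1|)
    exact ⟨(abs_le.1 h3).2, (abs_le.1 h3).1⟩
  have hwt : w t ≠ 0 := by
    intro h0
    have h3 := hwsign t ⟨htm, htT⟩
    have h4 : t ^ 2 - 1 ≠ 0 := by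
      intro h5
      rcases mul_eq_zero.1 (by linarith : (t - 1) * (t + 1) = 0) with h6 | h6
      · exact ht1 (by linarith)
      · linarith
    rcases lt_or_gt_of_ne h4 with h5 | h5
    · rw [abs_of_neg h5] at h3
      linarith
    · rw [abs_of_pos h5] at h3
      linarith
  have hGt : G t ≤ 0 := by
    rcases lt_or_gt_of_ne ht1 with hlt | hgt
    · rw [min_eq_left hlt.le, max_eq_right hlt.le] at hcont
      refine nonpos_of_deriv_pos_of_pos (G' := fun u => w u * B u) hlt.le
        (fun u hu => hcont u (htm.trans_le hu.1)) hG1 fun u hu hpos => ?_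
      have hum : -1 < u := htm.trans hu.1
      refine ⟨hGd u hum.ne' hu.2.ne, mul_pos_of_neg_of_neg ?_
        (hBneg u ⟨ht.1.trans hu.1, by linarith [hu.2]⟩ (hu.2.trans hT) hu.2.ne hpos)⟩
      have h5 : u ^ 2 - 1 < 0 := by nlinarith [hu.2]
      have h3 := (hwsign u ⟨hum, hu.2.trans hT⟩).1
      rw [abs_of_neg h5] at h3
      linarith
    · rw [min_eq_right hgt.le, max_eq_left hgt.le] at hcont
      refine nonpos_of_deriv_neg_of_pos (G' := fun u => w u * B u) hgt.le
        (fun u hu => hcont u (by linarith [hu.1])) hG1 fun u hu hpos => ?_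
      have hum : -1 < u := by linarith [hu.1]
      refine ⟨hGd u hum.ne' hu.1.ne', mul_neg_of_pos_of_neg ?_
        (hBneg u ⟨by linarith [hu.1], hu.2.trans ht.2⟩ (hu.2.trans htT) hu.1.ne' hpos)⟩
      have h5 : 0 < u ^ 2 - 1 := by nlinarith [hu.1]
      have h3 := (hwsign u ⟨hum, hu.2.trans htT⟩).2
      rw [abs_of_pos h5] at h3
      linarith
  rw [hGS t htm.ne' ht1] at hGt
  have : 0 < 2 * w t ^ 2 := by positivity
  nlinarith

theorem abs_second_deriv_le (h : NormalizedLanger s w w1 w2) {a η β : ℝ} (ha : 0 < a)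
    (hη : 0 ≤ η) (h2 : ∀ t ∈ Ioo (-1) β, |w2 t - 2 * a| ≤ 2 * a * η * (1 + |t|)) (hβ : 1 < β)
    (hsmall : η * (1 + β) ≤ 1 / 3000) :
    1 / 2 ≤ a ∧ ∀ t ∈ Ioo (-(3 / 5)) β, |deriv (deriv s) t| ≤ 2000 * η := by
  have est : ∀ T, 1 < T → T ≤ β → 3 * η * (1 + T) ≤ 1 / 1000 ∧ _ := fun T hT hTβ => by
    have hsm : 3 * η * (1 + T) ≤ 1 / 1000 := by
      have : η * (1 + T) ≤ η * (1 + β) := by gcongr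
      linarith
    exact ⟨hsm, h.near_identity ha hη (fun t ht => h2 t ⟨ht.1, ht.2.trans_le hTβ⟩) hT rfl
      (by linarith)⟩
  have hT2 : 1 < min β 2 := lt_min hβ (by norm_num)
  obtain ⟨hsm, ha1, hest⟩ := est (min β 2) hT2 (min_le_left _ _)
  have he9 : 3 * η * (1 + min β 2) ≤ 9 * η := by
    have : 3 * η * (1 + min β 2) ≤ 3 * η * (1 + 2) := by gcongr; exact min_le_right _ _
    linarith
  have hoff : ∀ t ∈ Ioo (-(3 / 5)) β, t ≠ 1 → |deriv (deriv s) t| ≤ 2000 * η := by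
    intro t ht ht1
    have htm : -1 < t := by linarith [ht.1]
    rcases le_or_gt t (1 / 2) with hlow | hlow
    · obtain ⟨-, e2, e3, e4⟩ := hest t ⟨htm, by linarith⟩
      have h5 := h.abs_second_deriv_le_of_far htm ht1 (by positivity) hsm e2 e3 (e4 ht1).1 (e4 ht1).2
      have h6 : |t| ≤ 3 / 5 := abs_le.2 ⟨ht.1.le, by linarith⟩
      have h7 : 0.64 ≤ |t ^ 2 - 1| := by
        rw [abs_of_neg (by nlinarith [abs_le.1 h6])]
        nlinarith [sq_abs t, abs_nonneg t]
      have h8 : 36 * (3 * η * (1 + min β 2)) * (1 + |t|) ≤ 36 * (9 * η) * (1 + 3 / 5) := by gcongr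
      nlinarith [abs_nonneg (deriv (deriv s) t)]
    rcases lt_or_ge t (3 / 2) with hhigh | hhigh
    · have htT : t < min β 2 := lt_min ht.2 (by linarith)
      have u1 := h.mul_second_deriv_le_of_near (σ := 1) (by simp) (by positivity) hsm hT2 hest
        ⟨hlow, hhigh⟩ htT ht1
      have u2 := h.mul_second_deriv_le_of_near (σ := -1) (by simp) (by positivity) hsm hT2 hest
        ⟨hlow, hhigh⟩ htT ht1
      rw [abs_le]
      constructor <;> linarith
    · have hTt : t < min β (t + 1) := lt_min ht.2 (by linarith)
      obtain ⟨hsm', -, hest'⟩ := est (min β (t + 1)) (by linarith) (min_le_left _ _)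
      obtain ⟨-, e2, e3, e4⟩ := hest' t ⟨htm, hTt⟩
      have h5 := h.abs_second_deriv_le_of_far htm ht1
        (mul_nonneg (by positivity) (by linarith)) hsm' e2 e3 (e4 ht1).1 (e4 ht1).2
      have h6 : 3 * η * (1 + min β (t + 1)) ≤ 3 * η * (2 + t) :=
        mul_le_mul_of_nonneg_left (by linarith [min_le_right β (t + 1)]) (by positivity)
      have ht0 : 0 < t := by linarith
      rw [abs_of_pos ht0, abs_of_pos (by nlinarith : 0 < t ^ 2 - 1)] at h5
      have h7 : 36 * (3 * η * (1 + min β (t + 1))) * (1 + t) ≤ 36 * (3 * η * (2 + t)) * (1 + t) := by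
        gcongr
      have h8 : |deriv (deriv s) t| * (t - 1) ≤ 36 * (3 * η * (2 + t)) := by
        refine le_of_mul_le_mul_right ?_ (by linarith : 0 < 1 + t)
        linarith
      have h9 : 36 * (3 * η * (2 + t)) ≤ 2000 * η * (t - 1) := by nlinarith
      exact le_of_mul_le_mul_right (h8.trans h9) (by linarith)
  refine ⟨by linarith [(abs_le.1 ha1).1], fun t ht => ?_⟩
  by_cases ht1 : t = 1
  · rw [ht1]
    exact abs_deriv_le_of_punctured (by positivity) (by norm_num : -(3 / 5 : ℝ) < 1) hβ
      fun y hy hy1 => ⟨(h.hasDerivAt_deriv (by linarith [hy.1] : -1 < y).ne' hy1).1.differentiableAt,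
        hoff y hy hy1⟩
  · exact hoff t ht ht1

end NormalizedLanger

namespace IsLanger

variable {W W1 W2 g : ℝ → ℝ} {xm xp b : ℝ}

theorem normalized (h : IsLanger W xm xp b g) (hm : W xm = 0) (hp : W xp = 0)
    (hW : ∀ x, HasDerivAt W (W1 x) x) (hW1 : ∀ x, HasDerivAt W1 (W2 x) x)
    {c m ρ : ℝ} (hc : 0 < c) (hcb : c = 2 * Real.sqrt (-b)) (hρ : 0 < ρ)
    (hxm : xm = m - ρ) (hxp : xp = m + ρ) :
    NormalizedLanger (fun t => g (m + ρ * t) / c) (fun t => 4 * ρ ^ 2 / c ^ 4 * W (m + ρ * t))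
      (fun t => 4 * ρ ^ 3 / c ^ 4 * W1 (m + ρ * t))
      (fun t => 4 * ρ ^ 4 / c ^ 4 * W2 (m + ρ * t)) := by
  obtain ⟨hcont, hmono, hgp, hgm, heqn⟩ := h
  have hc2 : c ^ 2 = -4 * b := by
    have hb : 0 < -b := by
      by_contra! hb
      rw [Real.sqrt_eq_zero_of_nonpos hb] at hcb
      linarith
    rw [hcb, mul_pow, Real.sq_sqrt hb.le]
    ring
  have haff : ∀ t, HasDerivAt (fun t => m + ρ * t) ρ t := fun t => by
    simpa using ((hasDerivAt_id t).const_mul ρ).const_add m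
  have h1 : m + ρ * 1 = xp := by rw [hxp]; ring
  have hm1 : m + ρ * (-1) = xm := by rw [hxm]; ring
  refine ⟨by fun_prop, ?_, ?_, ?_, ?_, ?_, ?_, ?_, ?_⟩
  · intro x y hxy
    have : g (m + ρ * x) < g (m + ρ * y) := hmono (by gcongr)
    simp only
    gcongr
  · simp only [h1, hgp, ← hcb]
    exact div_self hc.ne'
  · simp only [hm1, hgm, ← hcb]
    rw [neg_div, div_self hc.ne']
  · intro t htm ht1
    have hne1 : m + ρ * t ≠ xm := by
      rw [← hm1]
      intro h0
      exact htm (mul_left_cancel₀ hρ.ne' (add_left_cancel h0))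
    have hne2 : m + ρ * t ≠ xp := by
      rw [← h1]
      intro h0
      exact ht1 (mul_left_cancel₀ hρ.ne' (add_left_cancel h0))
    obtain ⟨hd, hpos, he⟩ := heqn _ hne1 hne2
    have hs : HasDerivAt (fun t => g (m + ρ * t) / c) (deriv g (m + ρ * t) * ρ / c) t :=
      (hd.hasDerivAt.comp t (haff t)).div_const c
    rw [hs.deriv]
    refine ⟨hs.differentiableAt, by positivity, ?_⟩
    rw [← he, show b = -c ^ 2 / 4 by rw [hc2]; ring]
    field_simp
    ring
  · simp only [h1, hp, mul_zero]
  · simp only [hm1, hm, mul_zero]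
  · intro t
    exact (((hW _).comp t (haff t)).const_mul _).congr_deriv (by ring)
  · intro t
    exact (((hW1 _).comp t (haff t)).const_mul _).congr_deriv (by ring)

theorem abs_second_deriv_le (h : IsLanger W xm xp b g) (hm : W xm = 0) (hp : W xp = 0)
    (hW : ∀ x, HasDerivAt W (W1 x) x) (hW1 : ∀ x, HasDerivAt W1 (W2 x) x) (hxm : xm < 0)
    (hxp : 0 < xp) {d ω M : ℝ} (hpd : xp < d) (hω : 0 < ω) (hM : 0 ≤ M)
    (hW2 : ∀ x ∈ Ioo xm d, |W2 x - ω| ≤ M * |x|) (hsmall : M * (d - xm) ≤ ω / 3000)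
    (hratio : xp ≤ -(3 / 2) * xm) {x : ℝ} (hx : xm / 2 < x) (hxd : x < d) :
    |deriv (deriv g) x| ≤ (1 + 4 * ω) * (2000 * (M / ω)) := by
  set ρ := (xp - xm) / 2 with hρd
  set m := (xp + xm) / 2 with hmd
  set c := 2 * Real.sqrt (-b) with hcd
  have hρ : 0 < ρ := by simp only [hρd]; linarith
  have hc : 0 < c := by
    have h1 := h.2.1 (hxm.trans hxp)
    rw [h.2.2.1, h.2.2.2.1] at h1
    linarith
  have hxm' : xm = m - ρ := by simp only [hρd, hmd]; ring
  have hxp' : xp = m + ρ := by simp only [hρd, hmd]; ring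
  have hmρ : |m| ≤ ρ := by
    rw [abs_le]
    constructor <;> linarith
  have hN := h.normalized hm hp hW hW1 hc rfl hρ hxm' hxp'
  have key := hN.abs_second_deriv_le (a := 2 * ρ ^ 4 * ω / c ^ 4) (η := M * ρ / ω)
    (β := (d - m) / ρ) (by positivity) (by positivity) ?_ ?_ ?_
  · obtain ⟨ha, hs⟩ := key
    have hcρ : c ≤ (1 + 4 * ω) * ρ := by
      rw [le_div_iff₀ (by positivity)] at ha
      refine le_of_pow_le_pow_left₀ (n := 4) (by norm_num) (by positivity) ?_
      have h1 : 4 * ω ≤ (1 + 4 * ω) ^ 4 := by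
        have : (1 + 4 * ω) ^ 1 ≤ (1 + 4 * ω) ^ 4 :=
          pow_le_pow_right₀ (by linarith) (by norm_num)
        linarith
      calc c ^ 4 ≤ 4 * ω * ρ ^ 4 := by linarith
        _ ≤ (1 + 4 * ω) ^ 4 * ρ ^ 4 := by gcongr
        _ = ((1 + 4 * ω) * ρ) ^ 4 := by ring
    have hd1 : ∀ f : ℝ → ℝ, deriv (fun t => f (m + ρ * t)) = fun t => ρ * deriv f (m + ρ * t) := by
      intro f
      funext t
      have h1 := deriv_comp_mul_left ρ (fun y => f (m + y)) t
      rw [h1, deriv_comp_const_add, smul_eq_mul]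
    have hd2 : deriv (deriv fun t => g (m + ρ * t) / c) =
        fun t => ρ ^ 2 / c * deriv (deriv g) (m + ρ * t) := by
      have e1 : (deriv fun t => g (m + ρ * t) / c) = fun t => ρ / c * deriv g (m + ρ * t) := by
        funext t
        rw [deriv_div_const, hd1]
        ring
      funext t
      rw [e1, deriv_const_mul_field, hd1]
      ring
    have ht := hs ((x - m) / ρ) ⟨?_, by gcongr⟩
    · rw [hd2] at ht
      simp only at ht
      rw [show m + ρ * ((x - m) / ρ) = x by field_simp; ring, abs_mul,
        abs_of_pos (by positivity : 0 < ρ ^ 2 / c)] at ht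
      calc |deriv (deriv g) x| = c / ρ ^ 2 * (ρ ^ 2 / c * |deriv (deriv g) x|) := by
            field_simp
        _ ≤ c / ρ ^ 2 * (2000 * (M * ρ / ω)) := by gcongr
        _ = c * (2000 * (M / ω) / ρ) := by field_simp
        _ ≤ (1 + 4 * ω) * ρ * (2000 * (M / ω) / ρ) := by gcongr
        _ = _ := by field_simp
    · rw [lt_div_iff₀ hρ]
      linarith
  · intro t ht
    have h1 : ρ * t < d - m := by
      have := (lt_div_iff₀ hρ).1 ht.2
      linarith
    have h2 : -ρ < ρ * t := by nlinarith [ht.1]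
    have h3 : |m + ρ * t| ≤ ρ * (1 + |t|) := by
      refine (abs_add_le _ _).trans ?_
      rw [abs_mul, abs_of_pos hρ]
      linarith
    have h4 := hW2 (m + ρ * t) ⟨by linarith, by linarith⟩
    rw [show 4 * ρ ^ 4 / c ^ 4 * W2 (m + ρ * t) - 2 * (2 * ρ ^ 4 * ω / c ^ 4) =
      4 * ρ ^ 4 / c ^ 4 * (W2 (m + ρ * t) - ω) by ring, abs_mul,
      abs_of_pos (by positivity : 0 < 4 * ρ ^ 4 / c ^ 4)]
    calc _ ≤ 4 * ρ ^ 4 / c ^ 4 * (M * (ρ * (1 + |t|))) := by gcongr; exact h4.trans (by gcongr)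
      _ = _ := by field_simp; ring
  · rw [lt_div_iff₀ hρ]
    linarith
  · rw [show M * ρ / ω * (1 + (d - m) / ρ) = M * (d - xm) / ω by rw [hxm']; field_simp; ring,
      div_le_iff₀ hω]
    linarith

end IsLanger

theorem abs_le_mul_abs_of_hasDerivAt {f f' : ℝ → ℝ} {d K : ℝ} (hf : ∀ x, HasDerivAt f (f' x) x)
    (h0 : f 0 = 0) (hK : ∀ x, |x| ≤ d → |f' x| ≤ K) {x : ℝ} (hx : |x| ≤ d) :
    |f x| ≤ K * |x| := by
  have hd : 0 ≤ d := (abs_nonneg x).trans hx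
  have := (convex_Icc (-d) d).norm_image_sub_le_of_norm_hasDerivWithin_le (f := f) (f' := f')
    (C := K) (x := 0) (y := x) (fun y _ => (hf y).hasDerivWithinAt)
    (fun y hy => hK y (abs_le.2 hy)) ⟨by linarith, hd⟩ (abs_le.1 hx)
  simpa [h0] using this

theorem abs_le_mul_sq_of_hasDerivAt {f f' f'' : ℝ → ℝ} {d K : ℝ}
    (hf : ∀ x, HasDerivAt f (f' x) x) (hf' : ∀ x, HasDerivAt f' (f'' x) x) (h0 : f 0 = 0)
    (h0' : f' 0 = 0) (hK : ∀ x, |x| ≤ d → |f'' x| ≤ K) {x : ℝ} (hx : |x| ≤ d) :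
    |f x| ≤ K * x ^ 2 := by
  have hK0 : 0 ≤ K := (abs_nonneg _).trans (hK x hx)
  have := abs_le_mul_abs_of_hasDerivAt (d := |x|) (K := K * |x|) hf h0 (fun y hy =>
    (abs_le_mul_abs_of_hasDerivAt hf' h0' hK (hy.trans hx)).trans (by gcongr)) le_rfl
  rwa [mul_assoc, abs_mul_abs_self, ← sq] at this

namespace SingleWell

variable {V : ℝ → ℝ → ℝ} {lammax δ pp pm Vp Vm : ℝ}

theorem hasDerivAt_iteratedDeriv (hV : SingleWell V lammax δ pp pm Vp Vm) {lam : ℝ}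
    (hlam : lam ∈ Icc 0 lammax) {n : ℕ} (hn : n < 5) (x : ℝ) :
    HasDerivAt (iteratedDeriv n fun x => V x lam) (iteratedDeriv (n + 1) (fun x => V x lam) x) x := by
  rw [iteratedDeriv_succ]
  exact ((hV.smooth lam hlam).differentiable_iteratedDeriv n (by exact_mod_cast hn) x).hasDerivAt

theorem continuousOn_iteratedDeriv (hV : SingleWell V lammax δ pp pm Vp Vm) {n : ℕ} (hn : n ≤ 5) :
    ContinuousOn (fun p : ℝ × ℝ => iteratedDeriv n (fun x => V x p.2) p.1)
      (Ioo (-δ) δ ×ˢ Icc 0 lammax) := by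
  simpa [pdermix] using hV.mixed_cont 0 (by norm_num) n hn

theorem exists_curvature_bounds (hV : SingleWell V lammax δ pp pm Vp Vm) :
    ∃ ω1 > 0, ∃ ω2, ∀ lam ∈ Icc 0 lammax, ω1 ≤ iteratedDeriv 2 (fun x => V x lam) 0 ∧
      iteratedDeriv 2 (fun x => V x lam) 0 ≤ ω2 := by
  have hc : ContinuousOn (fun lam => iteratedDeriv 2 (fun x => V x lam) 0) (Icc 0 lammax) :=
    (hV.continuousOn_iteratedDeriv (n := 2) (by norm_num)).comp
      (f := fun lam : ℝ => ((0 : ℝ), lam)) (by fun_prop)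
      fun lam hlam => ⟨⟨by linarith [hV.delta_pos], hV.delta_pos⟩, hlam⟩
  have hne : (Icc 0 lammax).Nonempty := ⟨0, le_rfl, hV.lammax_pos.le⟩
  obtain ⟨l1, hl1, h1⟩ := isCompact_Icc.exists_isMinOn hne hc
  obtain ⟨l2, hl2, h2⟩ := isCompact_Icc.exists_isMaxOn hne hc
  exact ⟨_, hV.d2V_pos l1 hl1, _, fun lam hlam => ⟨h1 hlam, h2 hlam⟩⟩

theorem exists_third_deriv_bound (hV : SingleWell V lammax δ pp pm Vp Vm) :
    ∃ M > 0, ∀ lam ∈ Icc 0 lammax, ∀ x, |x| ≤ δ / 2 →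
      |iteratedDeriv 3 (fun x => V x lam) x| ≤ M := by
  have hδ := hV.delta_pos
  have hsub : Icc (-(δ / 2)) (δ / 2) ×ˢ Icc 0 lammax ⊆ Ioo (-δ) δ ×ˢ Icc 0 lammax :=
    prod_mono (fun x hx => ⟨by linarith [hx.1], by linarith [hx.2]⟩) subset_rfl
  obtain ⟨M, hM⟩ := (isCompact_Icc.prod isCompact_Icc).exists_bound_of_continuousOn
    ((hV.continuousOn_iteratedDeriv (n := 3) (by norm_num)).mono hsub)
  refine ⟨max M 1, by positivity, fun lam hlam x hx => ?_⟩
  exact (hM (x, lam) ⟨abs_le.1 hx, hlam⟩).trans (le_max_left _ _)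

theorem strictMonoOn (hV : SingleWell V lammax δ pp pm Vp Vm) {lam : ℝ}
    (hlam : lam ∈ Icc 0 lammax) : StrictMonoOn (fun x => V x lam) (Ici 0) := by
  refine strictMonoOn_of_deriv_pos (convex_Ici 0) (hV.smooth lam hlam).continuous.continuousOn
    fun x hx => ?_
  rw [interior_Ici] at hx
  exact hV.dV_pos lam hlam x hx

theorem strictAntiOn (hV : SingleWell V lammax δ pp pm Vp Vm) {lam : ℝ}
    (hlam : lam ∈ Icc 0 lammax) : StrictAntiOn (fun x => V x lam) (Iic 0) := by
  refine strictAntiOn_of_deriv_neg (convex_Iic 0) (hV.smooth lam hlam).continuous.continuousOn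
    fun x hx => ?_
  rw [interior_Iic] at hx
  exact hV.dV_neg lam hlam x hx

theorem abs_second_deriv_sub_le (hV : SingleWell V lammax δ pp pm Vp Vm) {lam d M : ℝ}
    (hlam : lam ∈ Icc 0 lammax)
    (hM : ∀ x, |x| ≤ d → |iteratedDeriv 3 (fun x => V x lam) x| ≤ M) {x : ℝ} (hx : |x| ≤ d) :
    |iteratedDeriv 2 (fun x => V x lam) x - iteratedDeriv 2 (fun x => V x lam) 0| ≤ M * |x| :=
  abs_le_mul_abs_of_hasDerivAt
    (fun y => (hV.hasDerivAt_iteratedDeriv hlam (n := 2) (by norm_num) y).sub_const _)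
    (sub_self _) hM hx

theorem abs_sub_parabola_le (hV : SingleWell V lammax δ pp pm Vp Vm) {lam d K : ℝ}
    (hlam : lam ∈ Icc 0 lammax) (hK : ∀ x, |x| ≤ d →
      |iteratedDeriv 2 (fun x => V x lam) x - iteratedDeriv 2 (fun x => V x lam) 0| ≤ K)
    {x : ℝ} (hx : |x| ≤ d) :
    |V x lam - iteratedDeriv 2 (fun x => V x lam) 0 / 2 * x ^ 2| ≤ K * x ^ 2 := by
  set ω := iteratedDeriv 2 (fun x => V x lam) 0 with hω
  refine abs_le_mul_sq_of_hasDerivAt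
    (f := fun x => V x lam - ω / 2 * x ^ 2)
    (f' := fun x => iteratedDeriv 1 (fun x => V x lam) x - ω * x) (fun y => ?_) (fun y => ?_)
    ?_ ?_ hK hx
  · have h0 := hV.hasDerivAt_iteratedDeriv hlam (n := 0) (by norm_num) y
    rw [iteratedDeriv_zero] at h0
    exact (h0.fun_sub (((hasDerivAt_id y).fun_pow 2).const_mul (ω / 2))).congr_deriv
      (by simp; ring)
  · have h1 := hV.hasDerivAt_iteratedDeriv hlam (n := 1) (by norm_num) y
    exact (h1.fun_sub ((hasDerivAt_id y).const_mul ω)).congr_deriv (by simp)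
  · simp [hV.V_zero lam hlam]
  · simp [hV.dV_zero lam hlam]

end SingleWell

/-- **Upper bound on |g''(x;λ)| in the inner region.** -/
theorem langer_second_deriv_bound_inner (V : ℝ → ℝ → ℝ) (lammax δ pp pm Vp Vm : ℝ)
    (hV : SingleWell V lammax δ pp pm Vp Vm)
    (xm xp : ℝ → ℝ)
    (hx : ∀ lam : ℝ, 0 < lam → lam ≤ lammax →
      xm lam < 0 ∧ 0 < xp lam ∧ V (xm lam) lam = lam ∧ V (xp lam) lam = lam)
    (g : ℝ → ℝ → ℝ)
    (hg : ∀ lam : ℝ, 0 < lam → lam ≤ lammax →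
      IsLanger (fun x => V x lam - lam) (xm lam) (xp lam)
        (bParam (fun x => V x lam - lam) (xm lam) (xp lam)) (fun x => g x lam)) :
    ∃ δ0 > (0:ℝ), ∃ lam0 > (0:ℝ), lam0 ≤ lammax ∧ ∃ c > (0:ℝ),
      ∀ lam : ℝ, 0 < lam → lam ≤ lam0 →
        ∀ x : ℝ, (xm lam) / 2 < x → x < δ0 →
          |iteratedDeriv 2 (fun x' => g x' lam) x| ≤ c := by

  obtain ⟨ω1, hω1, ω2, hω⟩ := hV.exists_curvature_bounds
  obtain ⟨M, hM, hVM⟩ := hV.exists_third_deriv_bound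
  have hδ := hV.delta_pos
  have hlammax := hV.lammax_pos
  set d := min (δ / 2) (ω1 / (10000 * M)) with hd
  have hd0 : 0 < d := lt_min (by linarith) (by positivity)
  have hMd : M * d ≤ ω1 / 10000 := by
    calc M * d ≤ M * (ω1 / (10000 * M)) := by gcongr; exact min_le_right _ _
      _ = ω1 / 10000 := by field_simp
  have hω2 : 0 < ω2 := by
    obtain ⟨h1, h2⟩ := hω 0 ⟨le_rfl, hlammax.le⟩
    linarith
  refine ⟨d, hd0, min lammax (ω1 * d ^ 2 / 4), lt_min hlammax (by positivity), min_le_left _ _,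
    (1 + 4 * ω2) * (2000 * (M / ω1)), by positivity, fun lam hlam0 hlam x hx1 hx2 => ?_⟩
  have hlamm : lam ≤ lammax := hlam.trans (min_le_left _ _)
  have hlamd : lam ≤ ω1 * d ^ 2 / 4 := hlam.trans (min_le_right _ _)
  have hmem : lam ∈ Icc 0 lammax := ⟨hlam0.le, hlamm⟩
  obtain ⟨hxm, hxp, hVm, hVp⟩ := hx lam hlam0 hlamm
  obtain ⟨hωl, hωu⟩ := hω lam hmem
  have hV2 : ∀ y, |y| ≤ d → |iteratedDeriv 2 (fun x => V x lam) y -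
      iteratedDeriv 2 (fun x => V x lam) 0| ≤ M * |y| := fun y hy =>
    hV.abs_second_deriv_sub_le hmem (fun z hz => hVM lam hmem z hz) (hy.trans (min_le_left _ _))
  have hpar : ∀ y, |y| ≤ d → |V y lam - iteratedDeriv 2 (fun x => V x lam) 0 / 2 * y ^ 2| ≤
      ω1 / 10000 * y ^ 2 := fun y hy =>
    hV.abs_sub_parabola_le hmem (fun z hz => (hV2 z hz).trans
      ((by gcongr : M * |z| ≤ M * d).trans hMd)) hy
  set ω := iteratedDeriv 2 (fun x => V x lam) 0
  have hω0 : 0 < ω := by linarith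
  have hd2 : 0 < d ^ 2 := by positivity
  have hωd : ω1 * d ^ 2 ≤ ω * d ^ 2 := by gcongr
  have hωd0 : 0 < ω1 * d ^ 2 := by positivity
  have hxpd : xp lam < d := by
    by_contra! hle
    have h1 := (hV.strictMonoOn hmem).monotoneOn hd0.le hxp.le hle
    have h2 := (abs_le.1 (hpar d (abs_of_pos hd0).le)).1
    simp only [hVp] at h1
    linarith
  have hxmd : -d < xm lam := by
    by_contra! hle
    have h1 := (hV.strictAntiOn hmem).antitoneOn hxm.le (neg_nonpos.2 hd0.le) hle
    have h2 := (abs_le.1 (hpar (-d) (by rw [abs_neg, abs_of_pos hd0]))).1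
    simp only [hVm] at h1
    rw [neg_sq] at h2
    linarith
  have hratio : xp lam ≤ -(3 / 2) * xm lam := by
    have h1 := (abs_le.1 (hpar _ (by rw [abs_of_pos hxp]; exact hxpd.le))).1
    have h2 := (abs_le.1 (hpar _ (by rw [abs_of_neg hxm]; linarith))).2
    rw [hVp] at h1
    rw [hVm] at h2
    refine le_of_sq_le_sq ?_ (by linarith)
    have h3 : ω1 * xp lam ^ 2 ≤ ω * xp lam ^ 2 := by gcongr
    have h4 : ω1 * xm lam ^ 2 ≤ ω * xm lam ^ 2 := by gcongr
    refine le_of_mul_le_mul_left ?_ hω0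
    have : 0 ≤ ω * xm lam ^ 2 := by positivity
    linarith
  have hWm : V (xm lam) lam - lam = 0 := by rw [hVm, sub_self]
  have hWp : V (xp lam) lam - lam = 0 := by rw [hVp, sub_self]
  have hW : ∀ y, HasDerivAt (fun x => V x lam - lam) (iteratedDeriv 1 (fun x => V x lam) y) y := by
    intro y
    have := hV.hasDerivAt_iteratedDeriv hmem (n := 0) (by norm_num) y
    rw [iteratedDeriv_zero] at this
    exact this.sub_const lam
  have key := (hg lam hlam0 hlamm).abs_second_deriv_le hWm hWp hW
    (hV.hasDerivAt_iteratedDeriv hmem (n := 1) (by norm_num)) hxm hxp hxpd hω0 hM.le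
    (fun y hy => hV2 y (abs_le.2 ⟨by linarith [hy.1], hy.2.le⟩)) ?_ hratio hx1 hx2
  · rw [iteratedDeriv_succ, iteratedDeriv_one]
    refine key.trans ?_
    gcongr
  · have : M * (d - xm lam) ≤ M * (2 * d) := by gcongr; linarith
    linarith
end
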